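/- arXiv:1909.10935 — 5 statements merged into one kernel-verified Lean document; each statement's English description precedes it below -/
import Mathlib

section
/- Let n ≥ 1, let d ≥ 2 be even, and let ‖·‖ be any norm on the space F_{d,n} of real forms of degree d in n variables. Then the convex optimization problem of minimizing v(f) = vol{x ∈ ℝⁿ : f(x) ≤ 1} over all f ∈ F_{d,n} with ‖f‖ ≤ 1 has a unique optimal solution f*; that is, there exists a unique f* ∈ F_{d,n} with ‖f*‖ ≤ 1 and v(f*) finite such that v(f*) ≤ v(f) for every f ∈ F_{d,n} with ‖f‖ ≤ 1. Moreover this f* satisfies ‖f*‖ = 1. -/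
open MvPolynomial MeasureTheory Real Finset

/-- `v(f)`: the Lebesgue volume of the sublevel set `{x ∈ ℝⁿ : f(x) ≤ 1}`. -/
noncomputable def sublevelVol (n : ℕ) (f : MvPolynomial (Fin n) ℝ) : ENNReal :=
  volume {x : Fin n → ℝ | eval x f ≤ 1}

namespace MvPolynomial.IsHomogeneous

variable {n d : ℕ} {f : MvPolynomial (Fin n) ℝ}

lemma eval_real_smul (hf : f.IsHomogeneous d) (r : ℝ) (x : Fin n → ℝ) :
    eval (r • x) f = r ^ d * eval x f := by
  rw [eval_eq, eval_eq, Finset.mul_sum]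
  refine Finset.sum_congr rfl fun m hm => ?_
  have hdeg : ∑ i ∈ m.support, m i = d := (hf.degree_eq_sum_deg_support hm).symm
  simp only [Pi.smul_apply, smul_eq_mul, mul_pow, Finset.prod_mul_distrib,
    Finset.prod_pow_eq_pow_sum, hdeg]
  ring

lemma volume_sublevel (hf : f.IsHomogeneous d) (hd : d ≠ 0) {t : ℝ} (ht : 0 < t) :
    volume {x : Fin n → ℝ | eval x f ≤ t} =
      ENNReal.ofReal (t ^ ((n : ℝ) / d)) * sublevelVol n f := by
  have hr : 0 < t ^ ((d : ℝ)⁻¹) := Real.rpow_pos_of_pos ht _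
  have hset : {x : Fin n → ℝ | eval x f ≤ t} =
      ((t ^ ((d : ℝ)⁻¹))⁻¹ • ·) ⁻¹' {x : Fin n → ℝ | eval x f ≤ 1} := by
    ext x
    simp only [Set.mem_ofPred_eq, Set.mem_preimage, hf.eval_real_smul, inv_pow,
      Real.rpow_inv_natCast_pow ht.le hd]
    rw [inv_mul_le_iff₀ ht, mul_one]
  rw [hset, Measure.addHaar_preimage_smul _ (inv_ne_zero hr.ne'), sublevelVol]
  congr 2
  rw [Module.finrank_fin_fun, inv_pow, inv_inv, abs_of_pos (pow_pos hr n),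
    ← Real.rpow_natCast, ← Real.rpow_mul ht.le]
  congr 1
  ring

/-- A form whose sublevel set has finite volume is nonnegative. -/
lemma eval_nonneg_of_sublevelVol_lt_top (hf : f.IsHomogeneous d) (hn : n ≠ 0)
    (hv : sublevelVol n f < ⊤) (x : Fin n → ℝ) : 0 ≤ eval x f := by
  set s : Set (Fin n → ℝ) := {x | eval x f < 0} with hs
  have hopen : IsOpen s := isOpen_lt (MvPolynomial.continuous_eval f) continuous_const
  have hfin : volume s ≠ ⊤ := by
    refine ((measure_mono fun y hy => ?_).trans_lt hv).ne
    exact (show eval y f < 0 from hy).le.trans zero_le_one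
  have hscale : s = ((2⁻¹ : ℝ) • ·) ⁻¹' s := by
    ext y
    simp only [hs, Set.mem_ofPred_eq, Set.mem_preimage, hf.eval_real_smul]
    exact ⟨fun h => mul_neg_of_pos_of_neg (by positivity) h,
      fun h => (pos_iff_neg_of_mul_neg h).1 (by positivity)⟩
  have hvol : volume s = ENNReal.ofReal (2 ^ n) * volume s := by
    conv_lhs => rw [hscale, Measure.addHaar_preimage_smul _ (by norm_num)]
    rw [Module.finrank_fin_fun, inv_pow, inv_inv, abs_of_pos (by positivity)]
  have hzero : volume s = 0 := by
    have hreal := congrArg ENNReal.toReal hvol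
    rw [ENNReal.toReal_mul, ENNReal.toReal_ofReal (by positivity)] at hreal
    have hpow : (1 : ℝ) < 2 ^ n := one_lt_pow₀ one_lt_two hn
    have : (volume s).toReal = 0 := by nlinarith [ENNReal.toReal_nonneg (a := volume s)]
    exact ((ENNReal.toReal_eq_zero_iff _).1 this).resolve_right hfin
  have hempty : s = ∅ := hopen.measure_eq_zero_iff volume |>.1 hzero
  by_contra! hx
  exact (hempty ▸ (show x ∈ s from hx) : x ∈ (∅ : Set (Fin n → ℝ)))

end MvPolynomial.IsHomogeneous

lemma lintegral_exp_neg_indicator (y : ℝ) :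
    ∫⁻ t in Set.Ioi (0 : ℝ), (Set.Ici y).indicator (fun t => ENNReal.ofReal (exp (-t))) t =
      ENNReal.ofReal (exp (-max y 0)) := by
  rw [setLIntegral_congr Ioi_ae_eq_Ici, setLIntegral_indicator measurableSet_Ici,
    Set.Ici_inter_Ici, ← setLIntegral_congr Ioi_ae_eq_Ici,
    ← ofReal_integral_eq_lintegral_ofReal (integrableOn_exp_neg_Ioi _)
      (ae_of_all _ fun _ => (exp_pos _).le), integral_exp_neg_Ioi]

/-- The volume of the unit sublevel set of a form is, up to a Gamma factor, the integral of
`exp (-max f 0)`. -/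
lemma lintegral_exp_neg_max_eq {n d : ℕ} {f : MvPolynomial (Fin n) ℝ} (hf : f.IsHomogeneous d)
    (hd : d ≠ 0) :
    ∫⁻ x : Fin n → ℝ, ENNReal.ofReal (exp (-max (eval x f) 0)) =
      ENNReal.ofReal (Gamma ((n : ℝ) / d + 1)) * sublevelVol n f := by
  have hcont : Continuous fun x : Fin n → ℝ => eval x f := MvPolynomial.continuous_eval f
  have hs : (0 : ℝ) < (n : ℝ) / d + 1 := by positivity
  have hmeas : Measurable (Function.uncurry fun (x : Fin n → ℝ) (t : ℝ) =>
      (Set.Ici (eval x f)).indicator (fun t => ENNReal.ofReal (exp (-t))) t) := by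
    have : (Function.uncurry fun (x : Fin n → ℝ) (t : ℝ) =>
        (Set.Ici (eval x f)).indicator (fun t => ENNReal.ofReal (exp (-t))) t) =
        {p : (Fin n → ℝ) × ℝ | eval p.1 f ≤ p.2}.indicator
          (fun p => ENNReal.ofReal (exp (-p.2))) := by
      ext p
      simp [Function.uncurry, Set.indicator_apply]
    rw [this]
    refine Measurable.indicator (by fun_prop) ?_
    exact measurableSet_le (hcont.measurable.comp measurable_fst) measurable_snd
  calc ∫⁻ x : Fin n → ℝ, ENNReal.ofReal (exp (-max (eval x f) 0))
      = ∫⁻ x : Fin n → ℝ, ∫⁻ t in Set.Ioi (0 : ℝ),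
          (Set.Ici (eval x f)).indicator (fun t => ENNReal.ofReal (exp (-t))) t := by
        simp only [lintegral_exp_neg_indicator]
    _ = ∫⁻ t in Set.Ioi (0 : ℝ), ∫⁻ x : Fin n → ℝ,
          (Set.Ici (eval x f)).indicator (fun t => ENNReal.ofReal (exp (-t))) t :=
        lintegral_lintegral_swap hmeas.aemeasurable
    _ = ∫⁻ t in Set.Ioi (0 : ℝ),
          ENNReal.ofReal (exp (-t) * t ^ ((n : ℝ) / d + 1 - 1)) * sublevelVol n f := by
        refine setLIntegral_congr_fun measurableSet_Ioi fun t ht => ?_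
        have hind : ∀ x : Fin n → ℝ,
            (Set.Ici (eval x f)).indicator (fun t => ENNReal.ofReal (exp (-t))) t =
            {x : Fin n → ℝ | eval x f ≤ t}.indicator
              (fun _ => ENNReal.ofReal (exp (-t))) x := fun x => by
          simp [Set.indicator_apply]
        simp only [hind]
        rw [lintegral_indicator_const (measurableSet_le hcont.measurable measurable_const),
          hf.volume_sublevel hd ht, add_sub_cancel_right, ENNReal.ofReal_mul (exp_pos _).le,
          mul_assoc]
    _ = _ := by
        rw [lintegral_mul_const'' _ (by fun_prop), Gamma_eq_integral hs,
          ofReal_integral_eq_lintegral_ofReal (GammaIntegral_convergent hs)]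
        refine (ae_restrict_iff' measurableSet_Ioi).2 (ae_of_all _ fun t ht => ?_)
        exact mul_nonneg (exp_pos _).le (Real.rpow_nonneg (le_of_lt ht) _)

lemma exp_neg_half_add (a b : ℝ) :
    exp (-((a + b) / 2)) = exp (-a / 2) * exp (-b / 2) := by
  rw [← Real.exp_add]; congr 1; ring

lemma exp_neg_eq_sq (a : ℝ) : exp (-a) = exp (-a / 2) ^ 2 := by
  rw [← Real.exp_nat_mul]; congr 1; push_cast; ring

/-- Strict midpoint convexity of the volume on forms with sublevel sets of equal finite volume. -/
lemma eq_of_sublevelVol_le_midpoint {n d : ℕ} (hn : n ≠ 0) (hd : d ≠ 0)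
    {f g : MvPolynomial (Fin n) ℝ} (hf : f.IsHomogeneous d) (hg : g.IsHomogeneous d)
    (hfv : sublevelVol n f < ⊤) (hfg : sublevelVol n f = sublevelVol n g)
    (hmid : sublevelVol n f ≤ sublevelVol n ((1 / 2 : ℝ) • (f + g))) : f = g := by
  have hf0 := hf.eval_nonneg_of_sublevelVol_lt_top hn hfv
  have hg0 := hg.eval_nonneg_of_sublevelVol_lt_top hn (hfg ▸ hfv)
  set h : MvPolynomial (Fin n) ℝ := (1 / 2 : ℝ) • (f + g) with hh
  have hhom : h.IsHomogeneous d :=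
    (homogeneousSubmodule (Fin n) ℝ d).smul_mem _ (hf.add hg)
  have hev : ∀ x : Fin n → ℝ, eval x h = (eval x f + eval x g) / 2 := fun x => by
    rw [hh, smul_eval, map_add]; ring
  have hcf : Continuous fun x : Fin n → ℝ => eval x f := MvPolynomial.continuous_eval f
  have hcg : Continuous fun x : Fin n → ℝ => eval x g := MvPolynomial.continuous_eval g
  have If := lintegral_exp_neg_max_eq hf hd
  have Ig := lintegral_exp_neg_max_eq hg hd
  have Ih := lintegral_exp_neg_max_eq hhom hd
  simp only [hf0, max_eq_left] at If
  simp only [hg0, max_eq_left] at Ig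
  have hh0 : ∀ x, 0 ≤ eval x h := fun x => by rw [hev]; linarith [hf0 x, hg0 x]
  simp only [hh0, max_eq_left] at Ih
  simp only [hev] at Ih
  set A : (Fin n → ℝ) → ℝ := fun x => exp (-((eval x f + eval x g) / 2)) with hA
  set B : (Fin n → ℝ) → ℝ := fun x => (exp (-eval x f) + exp (-eval x g)) / 2 with hB
  have hAB : ∀ x, A x ≤ B x := fun x => by
    simp only [hA, hB]
    rw [exp_neg_half_add, exp_neg_eq_sq (eval x f), exp_neg_eq_sq (eval x g)]
    nlinarith [sq_nonneg (exp (-eval x f / 2) - exp (-eval x g / 2))]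
  have IB : ∫⁻ x, ENNReal.ofReal (B x) =
      ENNReal.ofReal (Gamma ((n : ℝ) / d + 1)) * sublevelVol n f := by
    have hBe : ∀ x, ENNReal.ofReal (B x) = ENNReal.ofReal (1 / 2) *
        (ENNReal.ofReal (exp (-eval x f)) + ENNReal.ofReal (exp (-eval x g))) := fun x => by
      rw [← ENNReal.ofReal_add (exp_pos _).le (exp_pos _).le, ← ENNReal.ofReal_mul (by norm_num)]
      congr 1
      simp only [hB]; ring
    simp only [hBe]
    rw [lintegral_const_mul' _ _ ENNReal.ofReal_ne_top,
      lintegral_add_left (by fun_prop), If, Ig, ← hfg, ← two_mul, ← mul_assoc,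
      show (2 : ENNReal) = ENNReal.ofReal 2 by simp, ← ENNReal.ofReal_mul (by norm_num)]
    norm_num
  have hBfin : ∫⁻ x, ENNReal.ofReal (B x) ≠ ⊤ := by
    rw [IB]; exact ENNReal.mul_ne_top ENNReal.ofReal_ne_top hfv.ne
  have hle : ∫⁻ x, ENNReal.ofReal (B x) ≤ ∫⁻ x, ENNReal.ofReal (A x) := by
    rw [IB, Ih]; gcongr
  have hAc : Continuous A := by fun_prop
  have hBc : Continuous B := by fun_prop
  have hmono : ∀ x, ENNReal.ofReal (A x) ≤ ENNReal.ofReal (B x) := fun x =>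
    ENNReal.ofReal_le_ofReal (hAB x)
  have hae := ae_eq_of_ae_le_of_lintegral_le (ae_of_all volume hmono)
    ((lintegral_mono hmono).trans_lt hBfin.lt_top).ne (by fun_prop) hle
  have heq := (Continuous.ae_eq_iff_eq volume (ENNReal.continuous_ofReal.comp hAc)
    (ENNReal.continuous_ofReal.comp hBc)).1 hae
  refine MvPolynomial.funext fun x => ?_
  have hx : A x = B x := by
    have hB0 : 0 ≤ B x := div_nonneg (add_nonneg (exp_pos _).le (exp_pos _).le) two_pos.le
    exact (ENNReal.ofReal_eq_ofReal_iff (exp_pos _).le hB0).1 (congrFun heq x)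
  simp only [hA, hB] at hx
  rw [exp_neg_half_add, exp_neg_eq_sq (eval x f), exp_neg_eq_sq (eval x g)] at hx
  have hsq : (exp (-eval x f / 2) - exp (-eval x g / 2)) ^ 2 = 0 := by linarith
  have := Real.exp_injective (sub_eq_zero.1 (pow_eq_zero_iff two_ne_zero |>.1 hsq))
  linarith

/-- The volume is lower semicontinuous along any family of forms with continuous evaluations. -/
lemma lowerSemicontinuous_sublevelVol {V : Type*} [TopologicalSpace V]
    [FirstCountableTopology V] {n d : ℕ} (hd : d ≠ 0) (φ : V → MvPolynomial (Fin n) ℝ)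
    (hφ : ∀ v, (φ v).IsHomogeneous d) (hcont : ∀ x, Continuous fun v => eval x (φ v)) :
    LowerSemicontinuous fun v => sublevelVol n (φ v) := by
  set c := ENNReal.ofReal (Gamma ((n : ℝ) / d + 1)) with hc
  have hc0 : c ≠ 0 := by
    rw [hc, ne_eq, ENNReal.ofReal_eq_zero, not_le]
    exact Gamma_pos_of_pos (by positivity)
  have hF : LowerSemicontinuous fun v =>
      ∫⁻ x : Fin n → ℝ, ENNReal.ofReal (exp (-max (eval x (φ v)) 0)) := by
    refine lowerSemicontinuous_iff_le_liminf.2 fun v => ?_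
    refine le_trans (le_of_eq ?_) (lintegral_liminf_le fun w => ?_)
    · refine lintegral_congr fun x => ?_
      have hx := hcont x
      have : Continuous fun v => ENNReal.ofReal (exp (-max (eval x (φ v)) 0)) :=
        ENNReal.continuous_ofReal.comp (by fun_prop)
      exact (this.tendsto v).liminf_eq.symm
    · have : Continuous fun x : Fin n → ℝ => eval x (φ w) := MvPolynomial.continuous_eval _
      exact (ENNReal.continuous_ofReal.comp (by fun_prop)).measurable
  have heq : (fun v => sublevelVol n (φ v)) = fun v =>
      c⁻¹ * ∫⁻ x : Fin n → ℝ, ENNReal.ofReal (exp (-max (eval x (φ v)) 0)) := by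
    ext v
    rw [lintegral_exp_neg_max_eq (hφ v) hd, ← mul_assoc,
      ENNReal.inv_mul_cancel hc0 ENNReal.ofReal_ne_top, one_mul]
  rw [heq]
  have hci : c⁻¹ ≠ ⊤ := ENNReal.inv_ne_top.2 hc0
  exact (ENNReal.continuous_const_mul hci).comp_lowerSemicontinuous hF
    fun a b hab => mul_le_mul_right hab _

/-- A positive multiple of `∑ Xᵢᵈ`, with `d` even, has a sublevel set of finite volume. -/
lemma sublevelVol_smul_sum_X_pow_lt_top {n d : ℕ} (hd : d ≠ 0) (hdeven : Even d) {c : ℝ}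
    (hc : 0 < c) : sublevelVol n (c • ∑ i, X i ^ d) < ⊤ := by
  set R : ℝ := max 1 c⁻¹
  refine (measure_mono (t := Metric.closedBall (0 : Fin n → ℝ) R) fun x hx => ?_).trans_lt
    measure_closedBall_lt_top
  rw [mem_closedBall_zero_iff, pi_norm_le_iff_of_nonneg (by positivity)]
  intro i
  simp only [Set.mem_ofPred_eq, smul_eval, map_sum, map_pow, eval_X] at hx
  have hi : x i ^ d ≤ ∑ j, x j ^ d :=
    Finset.single_le_sum (f := fun j => x j ^ d) (fun j _ => hdeven.pow_nonneg _)
      (Finset.mem_univ i)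
  have hle : x i ^ d ≤ R := by
    refine le_trans ?_ (le_max_right 1 c⁻¹)
    rw [← one_div, le_div_iff₀' hc]
    nlinarith
  by_contra! hlt
  rw [Real.norm_eq_abs] at hlt
  have h1 : 1 ≤ |x i| := (le_max_left _ _).trans hlt.le
  have h2 := le_self_pow₀ h1 hd
  rw [hdeven.pow_abs] at h2
  linarith

/-- The volume attains its minimum over the unit ball of any norm on a finite-dimensional space of
forms. -/
lemma exists_minimizer_sublevelVol {V : Type*} [AddCommGroup V] [Module ℝ V]
    [FiniteDimensional ℝ V] {n d : ℕ} (hd : d ≠ 0) (φ : V →ₗ[ℝ] MvPolynomial (Fin n) ℝ)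
    (hφ : ∀ v, (φ v).IsHomogeneous d) (N : V → ℝ) (N_nonneg : ∀ v, 0 ≤ N v)
    (N_add : ∀ v w, N (v + w) ≤ N v + N w) (N_smul : ∀ (c : ℝ) v, N (c • v) = |c| * N v)
    (N_eq_zero : ∀ v, N v = 0 ↔ v = 0) :
    ∃ v, N v ≤ 1 ∧ ∀ w, N w ≤ 1 → sublevelVol n (φ v) ≤ sublevelVol n (φ w) := by
  let : Norm V := ⟨N⟩
  have core : NormedSpace.Core ℝ V :=
    { norm_nonneg := N_nonneg
      norm_smul := N_smul
      norm_triangle := N_add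
      norm_eq_zero_iff := N_eq_zero }
  let : NormedAddCommGroup V := NormedAddCommGroup.ofCore core
  let : NormedSpace ℝ V := NormedSpace.ofCore core
  have : ProperSpace V := FiniteDimensional.proper ℝ V
  have hcont : ∀ x : Fin n → ℝ, Continuous fun v => eval x (φ v) := fun x =>
    LinearMap.continuous_of_finiteDimensional ((MvPolynomial.aeval x).toLinearMap ∘ₗ φ)
  have hlsc := lowerSemicontinuous_sublevelVol hd φ hφ hcont
  obtain ⟨v, hv, hmin⟩ := (hlsc.lowerSemicontinuousOn _).exists_isMinOn
    ⟨0, Metric.mem_closedBall_self zero_le_one⟩ (isCompact_closedBall (0 : V) 1)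
  exact ⟨v, mem_closedBall_zero_iff.1 hv, fun w hw =>
    isMinOn_iff.1 hmin w (mem_closedBall_zero_iff.2 hw)⟩

/-- The problem of minimizing `v(f)` over all forms `f` of degree `d` with `‖f‖ ≤ 1`
(where `‖·‖` is an arbitrary norm on the space of degree-`d` forms) has a unique optimal
solution `f*`, and moreover `‖f*‖ = 1`. -/
theorem stmt0 (n d : ℕ) (hn : 1 ≤ n) (hd : 2 ≤ d) (hdeven : Even d)
    (Nm : MvPolynomial (Fin n) ℝ → ℝ)
    (Nm_add : ∀ f g : MvPolynomial (Fin n) ℝ, f.IsHomogeneous d → g.IsHomogeneous d →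
      Nm (f + g) ≤ Nm f + Nm g)
    (Nm_smul : ∀ (c : ℝ) (f : MvPolynomial (Fin n) ℝ), f.IsHomogeneous d →
      Nm (c • f) = |c| * Nm f)
    (Nm_eq_zero : ∀ f : MvPolynomial (Fin n) ℝ, f.IsHomogeneous d → (Nm f = 0 ↔ f = 0)) :
    (∃! fstar : MvPolynomial (Fin n) ℝ,
      fstar.IsHomogeneous d ∧ Nm fstar ≤ 1 ∧ sublevelVol n fstar < ⊤ ∧
        ∀ f : MvPolynomial (Fin n) ℝ, f.IsHomogeneous d → Nm f ≤ 1 →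
          sublevelVol n fstar ≤ sublevelVol n f) ∧
    (∀ fstar : MvPolynomial (Fin n) ℝ,
      (fstar.IsHomogeneous d ∧ Nm fstar ≤ 1 ∧ sublevelVol n fstar < ⊤ ∧
        ∀ f : MvPolynomial (Fin n) ℝ, f.IsHomogeneous d → Nm f ≤ 1 →
          sublevelVol n fstar ≤ sublevelVol n f) →
      Nm fstar = 1) := by
  have hn0 : n ≠ 0 := by omega
  have hd0 : d ≠ 0 := by omega
  have hsmul : ∀ (c : ℝ) {f : MvPolynomial (Fin n) ℝ}, f.IsHomogeneous d →
      (c • f).IsHomogeneous d := fun c f hf => (homogeneousSubmodule (Fin n) ℝ d).smul_mem c hf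
  have Nm_nonneg : ∀ f : MvPolynomial (Fin n) ℝ, f.IsHomogeneous d → 0 ≤ Nm f := by
    intro f hf
    have h1 := Nm_add f ((-1 : ℝ) • f) hf (hsmul _ hf)
    rw [Nm_smul _ _ hf, neg_one_smul, add_neg_cancel,
      (Nm_eq_zero 0 (isHomogeneous_zero _ _ _)).2 rfl, abs_neg, abs_one] at h1
    linarith
  have huniq : ∀ f g : MvPolynomial (Fin n) ℝ,
      (f.IsHomogeneous d ∧ Nm f ≤ 1 ∧ sublevelVol n f < ⊤ ∧
        ∀ k : MvPolynomial (Fin n) ℝ, k.IsHomogeneous d → Nm k ≤ 1 →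
          sublevelVol n f ≤ sublevelVol n k) →
      g.IsHomogeneous d → Nm g ≤ 1 → sublevelVol n g ≤ sublevelVol n f → f = g := by
    rintro f g ⟨hf, hf1, hfv, hfmin⟩ hg hg1 hgf
    refine eq_of_sublevelVol_le_midpoint hn0 hd0 hf hg hfv (le_antisymm (hfmin g hg hg1) hgf)
      (hfmin _ (hsmul _ (hf.add hg)) ?_)
    rw [Nm_smul _ _ (hf.add hg), abs_of_pos (by norm_num)]
    linarith [Nm_add f g hf hg]
  refine ⟨?_, ?_⟩
  · have : FiniteDimensional ℝ (homogeneousSubmodule (Fin n) ℝ d) :=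
      Module.Finite.iff_fg.2 (homogeneousSubmodule_fg (Fin n) ℝ d)
    obtain ⟨⟨f, hf⟩, hf1, hmin'⟩ := exists_minimizer_sublevelVol hd0
      (homogeneousSubmodule (Fin n) ℝ d).subtype (fun v => v.2) (fun v => Nm v)
      (fun v => Nm_nonneg v v.2) (fun v w => Nm_add v w v.2 w.2) (fun c v => Nm_smul c v v.2)
      (fun v => (Nm_eq_zero v v.2).trans Submodule.coe_eq_zero)
    have hmin : ∀ k : MvPolynomial (Fin n) ℝ, k.IsHomogeneous d → Nm k ≤ 1 →
        sublevelVol n f ≤ sublevelVol n k := fun k hk hk1 => hmin' ⟨k, hk⟩ hk1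
    have hp : (∑ i, X i ^ d : MvPolynomial (Fin n) ℝ).IsHomogeneous d :=
      IsHomogeneous.sum _ _ _ fun i _ => isHomogeneous_X_pow i d
    have hN := Nm_nonneg _ hp
    have hc : 0 < (Nm (∑ i, X i ^ d) + 1)⁻¹ := by positivity
    have hfv : sublevelVol n f < ⊤ := by
      refine (hmin _ (hsmul (Nm (∑ i, X i ^ d) + 1)⁻¹ hp) ?_).trans_lt
        (sublevelVol_smul_sum_X_pow_lt_top hd0 hdeven hc)
      rw [Nm_smul _ _ hp, abs_of_pos hc, inv_mul_le_iff₀ (by positivity)]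
      linarith
    refine ⟨f, ⟨hf, hf1, hfv, hmin⟩, ?_⟩
    rintro g ⟨hg, hg1, -, hgmin⟩
    exact (huniq f g ⟨hf, hf1, hfv, hmin⟩ hg hg1 (hgmin f hf hf1)).symm
  · rintro f hopt
    obtain ⟨hf, hf1, hfv, hmin⟩ := hopt
    have hf0 : f ≠ 0 := by
      rintro rfl
      have : Nonempty (Fin n) := ⟨⟨0, hn⟩⟩
      simp [sublevelVol] at hfv
    have hpos : 0 < Nm f :=
      (Nm_nonneg f hf).lt_of_ne fun h => hf0 ((Nm_eq_zero f hf).1 h.symm)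
    have hinv : 1 ≤ (Nm f)⁻¹ := (one_le_inv₀ hpos).2 hf1
    have hfnn := hf.eval_nonneg_of_sublevelVol_lt_top hn0 hfv
    have hNg : Nm ((Nm f)⁻¹ • f) = 1 := by
      rw [Nm_smul _ _ hf, abs_of_pos (by positivity), inv_mul_cancel₀ hpos.ne']
    have hle : sublevelVol n ((Nm f)⁻¹ • f) ≤ sublevelVol n f := by
      refine measure_mono fun x hx => ?_
      simp only [Set.mem_ofPred_eq, smul_eval] at hx ⊢
      nlinarith [hfnn x]
    have heq := huniq f _ ⟨hf, hf1, hfv, hmin⟩ (hsmul _ hf) hNg.le hle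
    rw [heq, hNg]
end

section
/- Let n ≥ 1, let d ≥ 2 be even, and let ‖·‖ be an O(n)-invariant norm on F_{d,n}. Then for every f ∈ F_{d,n} with ‖f‖ ≤ 1 one has v(f) ≥ ‖b_{d,n}‖^{n/d} · π^{n/2}/Γ(n/2+1), and equality holds if and only if f = b_{d,n}/‖b_{d,n}‖. -/
open MvPolynomial MeasureTheory Real Finset Matrix

/-- `b_{d,n}(x) = (x₁² + ⋯ + x_n²)^{d/2}`. -/
noncomputable def ballForm (n d : ℕ) : MvPolynomial (Fin n) ℝ :=
  (∑ i : Fin n, X i ^ 2) ^ (d / 2)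

/-- `π^{n/2} / Γ(n/2 + 1)`, the volume of the unit Euclidean ball in `ℝⁿ`. -/
noncomputable def unitBallVol (n : ℕ) : ℝ :=
  π ^ ((n : ℝ) / 2) / Real.Gamma ((n : ℝ) / 2 + 1)

/-- `ρ*f`: the form `x ↦ f(ρ⁻¹ x)`. -/
noncomputable def rotate (n : ℕ) (ρ : Matrix (Fin n) (Fin n) ℝ)
    (f : MvPolynomial (Fin n) ℝ) : MvPolynomial (Fin n) ℝ :=
  aeval (fun i => ∑ j : Fin n, C (ρ⁻¹ i j) * X j) f

lemma eval_smul_of_isHomogeneous {n d : ℕ} {f : MvPolynomial (Fin n) ℝ} (hf : f.IsHomogeneous d)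
    (s : ℝ) (x : Fin n → ℝ) : eval (s • x) f = s ^ d * eval x f := by
  rw [eval_eq', eval_eq', Finset.mul_sum]
  refine Finset.sum_congr rfl fun m hm => ?_
  have hm' : ∑ i, m i = d := by
    rw [← Finsupp.degree_eq_sum]
    rw [Finsupp.degree_eq_weight_one]
    exact hf (mem_support_iff.1 hm)
  simp only [Pi.smul_apply, smul_eq_mul, mul_pow, Finset.prod_mul_distrib]
  rw [Finset.prod_pow_eq_pow_sum, hm']
  ring

lemma eval_ballForm (n d : ℕ) (x : Fin n → ℝ) :
    eval x (ballForm n d) = (∑ i, x i ^ 2) ^ (d / 2) := by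
  simp [ballForm]

lemma isHomogeneous_ballForm (n : ℕ) {d : ℕ} (hd : Even d) : (ballForm n d).IsHomogeneous d := by
  have h : (∑ i : Fin n, X i ^ 2 : MvPolynomial (Fin n) ℝ).IsHomogeneous 2 :=
    IsHomogeneous.sum _ _ _ fun i _ => isHomogeneous_X_pow i 2
  simpa [ballForm, Nat.two_mul_div_two_of_even hd] using h.pow (d / 2)

lemma eval_rotate (n : ℕ) (ρ : Matrix (Fin n) (Fin n) ℝ) (f : MvPolynomial (Fin n) ℝ)
    (x : Fin n → ℝ) : eval x (rotate n ρ f) = eval (ρ⁻¹ *ᵥ x) f := by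
  rw [rotate, aeval_def, ← coe_eval₂Hom, ← RingHom.comp_apply]
  refine congrArg (fun φ : MvPolynomial (Fin n) ℝ →+* ℝ => φ f) ?_
  ext i <;> simp [mulVec, dotProduct]

lemma isHomogeneous_rotate {n d : ℕ} (ρ : Matrix (Fin n) (Fin n) ℝ) {f : MvPolynomial (Fin n) ℝ}
    (hf : f.IsHomogeneous d) : (rotate n ρ f).IsHomogeneous d := by
  have := hf.aeval (S := ℝ) (fun i => ∑ j : Fin n, C (ρ⁻¹ i j) * X j) (n := 1)
    fun i => IsHomogeneous.sum _ _ _ fun j _ => isHomogeneous_C_mul_X _ _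
  simpa [rotate] using this

lemma exists_orthogonal_mulVec_eq {n : ℕ} {x y : Fin n → ℝ} (h : x ⬝ᵥ x = y ⬝ᵥ y) :
    ∃ ρ : Matrix (Fin n) (Fin n) ℝ, ρ * ρᵀ = 1 ∧ ρ *ᵥ x = y := by
  by_cases hxy : x = y
  · exact ⟨1, by simp, by simpa using hxy⟩
  set v := x - y with hv
  have hv0 : v ⬝ᵥ v ≠ 0 := fun h0 => hxy (sub_eq_zero.1 (dotProduct_self_eq_zero.1 h0))
  have hvx : v ⬝ᵥ v = 2 * (v ⬝ᵥ x) := by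
    simp only [hv, dotProduct_sub, sub_dotProduct, dotProduct_comm x y]
    linarith
  refine ⟨1 - (2 / (v ⬝ᵥ v)) • vecMulVec v v, ?_, ?_⟩
  · have hsq : vecMulVec v v * vecMulVec v v = (v ⬝ᵥ v) • vecMulVec v v := by
      rw [vecMulVec_mul_vecMulVec, vecMulVec_smul']
      simp
    simp only [transpose_sub, transpose_one, transpose_smul, transpose_vecMulVec, mul_sub, sub_mul,
      one_mul, mul_one, smul_mul_assoc, mul_smul_comm, hsq, smul_smul]
    rw [div_mul_cancel₀ _ hv0]
    module
  · rw [sub_mulVec, one_mulVec, smul_mulVec, vecMulVec_mulVec]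
    have : (2 / (v ⬝ᵥ v)) * (v ⬝ᵥ x) = 1 := by
      rw [div_mul_eq_mul_div, ← hvx, div_self hv0]
    ext i
    simp only [Pi.sub_apply, Pi.smul_apply, MulOpposite.smul_eq_mul_unop, MulOpposite.unop_op,
      smul_eq_mul]
    rw [mul_comm (v i), ← mul_assoc, this]
    simp [hv]

lemma eq_smul_ballForm_of_rotate_eq {n d : ℕ} (hn : 1 ≤ n) (hd : Even d)
    {h : MvPolynomial (Fin n) ℝ} (hh : h.IsHomogeneous d)
    (hrot : ∀ ρ : Matrix (Fin n) (Fin n) ℝ, ρ * ρᵀ = 1 → rotate n ρ h = h) :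
    ∃ c : ℝ, h = c • ballForm n d := by
  obtain ⟨m, rfl⟩ := hd.two_dvd
  set e : Fin n → ℝ := Pi.single ⟨0, hn⟩ 1 with he
  refine ⟨eval e h, MvPolynomial.funext fun x => ?_⟩
  have hxx : x ⬝ᵥ x = ∑ i, x i ^ 2 := by simp [dotProduct, sq]
  have hr : 0 ≤ ∑ i, x i ^ 2 := Finset.sum_nonneg fun i _ => sq_nonneg _
  obtain ⟨ρ, hρ, hρx⟩ := exists_orthogonal_mulVec_eq (x := √(∑ i, x i ^ 2) • e) (y := x) (by
    rw [hxx, smul_dotProduct, dotProduct_smul]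
    simp [he, Real.mul_self_sqrt hr])
  have hunit : IsUnit ρ.det := (ρ.isUnit_iff_isUnit_det).1 (IsUnit.of_mul_eq_one _ hρ)
  have := eval_rotate n ρ h x
  rw [hrot ρ hρ, ← hρx, mulVec_mulVec, nonsing_inv_mul _ hunit, one_mulVec, hρx,
    eval_smul_of_isHomogeneous hh, pow_mul, Real.sq_sqrt hr] at this
  rw [this, smul_eval, eval_ballForm, mul_comm]
  simp

lemma setIntegral_mulVec_eq {n : ℕ} {A : Matrix (Fin n) (Fin n) ℝ} (hA : A * Aᵀ = 1)
    {E : Set (Fin n → ℝ)} (hE : MeasurableSet E) (hEA : ∀ x, A *ᵥ x ∈ E ↔ x ∈ E)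
    {F : (Fin n → ℝ) → ℝ} (hF : Continuous F) : ∫ x in E, F (A *ᵥ x) = ∫ x in E, F x := by
  have hdet : |A.det| = 1 := by
    have := congrArg Matrix.det hA
    rw [det_mul, det_transpose, det_one] at this
    rcases mul_self_eq_one_iff.1 this with h | h <;> simp [h]
  have hdet0 : A.det ≠ 0 := fun h => by simp [h] at hdet
  have hmap : Measure.map (toLin' A) volume = volume := by
    rw [Real.map_matrix_volume_pi_eq_smul_volume_pi hdet0, abs_inv, hdet]
    simp
  have hcont : Continuous (toLin' A) := LinearMap.continuous_of_finiteDimensional _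
  conv_rhs => rw [← hmap]
  rw [setIntegral_map hE hF.aestronglyMeasurable hcont.measurable.aemeasurable]
  have : toLin' A ⁻¹' E = E := by ext x; simpa using hEA x
  rw [this]
  simp

lemma exists_unique_constrained_norm_minimizer {V : Type*} [NormedAddCommGroup V]
    [InnerProductSpace ℝ V] [FiniteDimensional ℝ V] {N : V → ℝ} (hN : ConvexOn ℝ Set.univ N)
    (L : V →ₗ[ℝ] ℝ) (f : V) :
    ∃ h, N h ≤ N f ∧ L h = L f ∧
      ∀ h', N h' ≤ N f → L h' = L f → ‖h'‖ ≤ ‖h‖ → h' = h := by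
  let K : Set V := {p | N p ≤ N f} ∩ {p | L p = L f}
  have hcont : Continuous N := continuousOn_univ.1 (hN.continuousOn isOpen_univ)
  have hclosed : IsClosed K := (isClosed_le hcont continuous_const).inter
    (isClosed_eq L.continuous_of_finiteDimensional continuous_const)
  have hconv : Convex ℝ K := by
    refine Convex.inter ?_ ((convex_singleton (L f)).linear_preimage L)
    simpa using hN.convex_le (N f)
  have : CompleteSpace V := FiniteDimensional.complete ℝ V
  obtain ⟨h, hhK, hh⟩ := exists_norm_eq_iInf_of_complete_convex
    (K := K) ⟨f, le_refl (N f), rfl⟩ hclosed.isComplete hconv 0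
  refine ⟨h, hhK.1, hhK.2, fun h' hN' hL' hle => ?_⟩
  have hinner := (norm_eq_iInf_iff_real_inner_le_zero hconv hhK).1 hh h' ⟨hN', hL'⟩
  rw [zero_sub, inner_neg_left] at hinner
  have hexp : ‖h' - h‖ ^ 2 = ‖h'‖ ^ 2 - ‖h‖ ^ 2 - 2 * inner ℝ h (h' - h) := by
    rw [norm_sub_sq_real, inner_sub_right, real_inner_self_eq_norm_sq, real_inner_comm]
    ring
  have hsq : ‖h'‖ ^ 2 ≤ ‖h‖ ^ 2 := by gcongr
  have hnonpos : ‖h' - h‖ ^ 2 ≤ 0 := by linarith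
  exact sub_eq_zero.1 (norm_eq_zero.1 (pow_eq_zero_iff two_ne_zero |>.1
    (le_antisymm hnonpos (sq_nonneg _))))

lemma eq_zero_of_eval_eq_zero_of_isOpen {n : ℕ} {p : MvPolynomial (Fin n) ℝ}
    {U : Set (Fin n → ℝ)} (hU : IsOpen U) (hne : U.Nonempty) (h : ∀ x ∈ U, eval x p = 0) :
    p = 0 := by
  obtain ⟨x, hx⟩ := hne
  obtain ⟨ε, hε, hball⟩ := Metric.isOpen_iff.1 hU x hx
  refine funext_set (fun i => Metric.ball (x i) ε)
    (fun i => infinite_of_mem_nhds _ (Metric.ball_mem_nhds _ hε)) fun y hy => ?_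
  rw [map_zero]
  exact h y (hball (by rwa [ball_pi _ hε]))

lemma integrableOn_eval {n : ℕ} {E : Set (Fin n → ℝ)} (hE : IsCompact E)
    (p : MvPolynomial (Fin n) ℝ) : IntegrableOn (fun x => eval x p) E :=
  (MvPolynomial.continuous_eval p).continuousOn.integrableOn_compact hE

/-- The `L²(E)` inner product on forms of degree `d`. -/
@[reducible]
noncomputable def formInnerCore (n d : ℕ) {E : Set (Fin n → ℝ)} (hE : IsCompact E)
    (hint : (interior E).Nonempty) :
    InnerProductSpace.Core ℝ (homogeneousSubmodule (Fin n) ℝ d) where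
  inner p q := ∫ x in E, eval x (p * q : MvPolynomial (Fin n) ℝ)
  conj_inner_symm p q := by simp [mul_comm]
  re_inner_nonneg p := by
    simpa using integral_nonneg fun x => mul_self_nonneg (eval x (p : MvPolynomial (Fin n) ℝ))
  add_left p q r := by
    simp only [Submodule.coe_add, add_mul, map_add]
    exact integral_add (integrableOn_eval hE _) (integrableOn_eval hE _)
  smul_left p q c := by
    simp only [Submodule.coe_smul, smul_mul_assoc, smul_eval, integral_const_mul]
    simp
  definite p hp := by
    have hnn : 0 ≤ fun x => eval x (p * p : MvPolynomial (Fin n) ℝ) := fun x => by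
      simpa using mul_self_nonneg (eval x (p : MvPolynomial (Fin n) ℝ))
    have hae := (setIntegral_eq_zero_iff_of_nonneg_ae (ae_of_all _ hnn)
      (integrableOn_eval hE _)).1 hp
    have hzero : volume ({x | eval x (p : MvPolynomial (Fin n) ℝ) ≠ 0} ∩ interior E) = 0 := by
      refine measure_mono_null ?_ (ae_iff.1 ((ae_restrict_iff' hE.measurableSet).1 hae))
      rintro x ⟨hx, hxE⟩ hx'
      exact hx (by simpa using hx' (interior_subset hxE))
    have hopen : IsOpen {x | eval x (p : MvPolynomial (Fin n) ℝ) ≠ 0} :=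
      isOpen_ne_fun (MvPolynomial.continuous_eval _) continuous_const
    have hempty := ((hopen.inter isOpen_interior).measure_eq_zero_iff volume).1 hzero
    refine Subtype.ext (eq_zero_of_eval_eq_zero_of_isOpen isOpen_interior hint fun x hx => ?_)
    by_contra hne
    exact hempty.subset ⟨hne, hx⟩

lemma exists_smul_ballForm_average {n d : ℕ} (hn : 1 ≤ n) (hdeven : Even d)
    {Nm : MvPolynomial (Fin n) ℝ → ℝ}
    (Nm_add : ∀ f g : MvPolynomial (Fin n) ℝ, f.IsHomogeneous d → g.IsHomogeneous d →
      Nm (f + g) ≤ Nm f + Nm g)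
    (Nm_smul : ∀ (c : ℝ) (f : MvPolynomial (Fin n) ℝ), f.IsHomogeneous d →
      Nm (c • f) = |c| * Nm f)
    (Nm_inv : ∀ ρ : Matrix (Fin n) (Fin n) ℝ, ρ * ρᵀ = 1 →
      ∀ f : MvPolynomial (Fin n) ℝ, f.IsHomogeneous d → Nm (rotate n ρ f) = Nm f)
    {E : Set (Fin n → ℝ)} (hE : IsCompact E) (hint : (interior E).Nonempty)
    (hEinv : ∀ A : Matrix (Fin n) (Fin n) ℝ, A * Aᵀ = 1 → ∀ x, A *ᵥ x ∈ E ↔ x ∈ E)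
    {f : MvPolynomial (Fin n) ℝ} (hf : f.IsHomogeneous d) :
    ∃ c : ℝ, Nm (c • ballForm n d) ≤ Nm f ∧
      ∫ x in E, eval x (c • ballForm n d) = ∫ x in E, eval x f := by
  let core := formInnerCore n d hE hint
  let : NormedAddCommGroup (homogeneousSubmodule (Fin n) ℝ d) := core.toNormedAddCommGroup
  let : InnerProductSpace ℝ (homogeneousSubmodule (Fin n) ℝ d) :=
    InnerProductSpace.ofCore core.toCore
  have : FiniteDimensional ℝ (homogeneousSubmodule (Fin n) ℝ d) :=
    Module.Finite.iff_fg.2 (homogeneousSubmodule_fg _ _ d)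
  have hnorm (p : homogeneousSubmodule (Fin n) ℝ d) :
      ‖p‖ ^ 2 = ∫ x in E, eval x (p * p : MvPolynomial (Fin n) ℝ) :=
    (real_inner_self_eq_norm_sq p).symm
  let L : homogeneousSubmodule (Fin n) ℝ d →ₗ[ℝ] ℝ :=
    { toFun := fun p => ∫ x in E, eval x (p : MvPolynomial (Fin n) ℝ)
      map_add' := fun p q => by
        simp only [Submodule.coe_add, map_add]
        exact integral_add (integrableOn_eval hE _) (integrableOn_eval hE _)
      map_smul' := fun c p => by
        simp only [Submodule.coe_smul, smul_eval, integral_const_mul]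
        simp }
  have hconvN : ConvexOn ℝ Set.univ
      fun p : homogeneousSubmodule (Fin n) ℝ d => Nm (p : MvPolynomial (Fin n) ℝ) := by
    refine ⟨convex_univ, fun p _ q _ a b ha hb _ => ?_⟩
    have h := Nm_add _ _ (a • p).2 (b • q).2
    rwa [Submodule.coe_smul, Submodule.coe_smul, Nm_smul a _ p.2, Nm_smul b _ q.2,
      abs_of_nonneg ha, abs_of_nonneg hb] at h
  let f' : homogeneousSubmodule (Fin n) ℝ d := ⟨f, hf⟩
  obtain ⟨h, hhN, hhL, hmin⟩ := exists_unique_constrained_norm_minimizer hconvN L f'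
  have hrot (ρ : Matrix (Fin n) (Fin n) ℝ) (hρ : ρ * ρᵀ = 1) :
      rotate n ρ (h : MvPolynomial (Fin n) ℝ) = h := by
    have hA : ρ⁻¹ * (ρ⁻¹)ᵀ = 1 := by
      rw [inv_eq_right_inv hρ, transpose_transpose]
      exact mul_eq_one_comm.1 hρ
    have hinv (p : MvPolynomial (Fin n) ℝ) :
        ∫ x in E, eval (ρ⁻¹ *ᵥ x) p = ∫ x in E, eval x p :=
      setIntegral_mulVec_eq hA hE.measurableSet (hEinv _ hA) (MvPolynomial.continuous_eval p)
    let h' : homogeneousSubmodule (Fin n) ℝ d := ⟨rotate n ρ h, isHomogeneous_rotate ρ h.2⟩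
    refine congrArg Subtype.val (hmin h' ?_ ?_ ?_)
    · exact (Nm_inv ρ hρ _ h.2).trans_le hhN
    · refine Eq.trans ?_ hhL
      simp only [L, h', LinearMap.coe_mk, AddHom.coe_mk, eval_rotate, hinv]
    · refine le_of_eq ((sq_eq_sq₀ (norm_nonneg _) (norm_nonneg _)).1 ?_)
      rw [hnorm, hnorm, ← hinv (h * h : MvPolynomial (Fin n) ℝ)]
      simp only [h', map_mul, eval_rotate]
  obtain ⟨c, hc⟩ := eq_smul_ballForm_of_rotate_eq hn hdeven h.2 hrot
  exact ⟨c, hc ▸ hhN, hc ▸ hhL⟩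

lemma volume_sublevel_of_pos {n d : ℕ} (hd : d ≠ 0) {f : MvPolynomial (Fin n) ℝ}
    (hf : f.IsHomogeneous d) {s : ℝ} (hs : 0 < s) :
    volume {x : Fin n → ℝ | eval x f ≤ s} =
      ENNReal.ofReal (s ^ ((n : ℝ) / d)) * sublevelVol n f := by
  set r := s ^ (d : ℝ)⁻¹ with hr
  have hr0 : 0 < r := Real.rpow_pos_of_pos hs _
  have hrd : r ^ d = s := Real.rpow_inv_natCast_pow hs.le hd
  have hrn : r ^ n = s ^ ((n : ℝ) / d) := by
    rw [hr, ← Real.rpow_natCast, ← Real.rpow_mul hs.le, inv_mul_eq_div]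
  have hset : {x : Fin n → ℝ | eval x f ≤ s} = (r⁻¹ • ·) ⁻¹' {x | eval x f ≤ 1} := by
    ext x
    simp only [Set.mem_preimage, Set.mem_ofPred_eq, eval_smul_of_isHomogeneous hf, inv_pow, hrd]
    rw [inv_mul_le_one₀ hs]
  rw [hset, Measure.addHaar_preimage_smul _ (inv_ne_zero hr0.ne'), Module.finrank_fin_fun, inv_pow,
    inv_inv, hrn, abs_of_pos (Real.rpow_pos_of_pos hs _), sublevelVol]

lemma volume_nonpos_eq_zero {n d : ℕ} (hn : n ≠ 0) (hd : d ≠ 0) {f : MvPolynomial (Fin n) ℝ}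
    (hf : f.IsHomogeneous d) (hv : sublevelVol n f ≠ ⊤) :
    volume {x : Fin n → ℝ | eval x f ≤ 0} = 0 := by
  have hexp : 0 < (n : ℝ) / d := by positivity
  have hcont : Filter.Tendsto (fun s : ℝ => ENNReal.ofReal (s ^ ((n : ℝ) / d)) * sublevelVol n f)
      (nhdsWithin 0 (Set.Ioi 0)) (nhds 0) := by
    have h0 := (Real.continuousAt_rpow_const 0 ((n : ℝ) / d) (Or.inr hexp.le)).tendsto
    rw [Real.zero_rpow hexp.ne'] at h0
    simpa using ENNReal.Tendsto.mul_const
      (ENNReal.tendsto_ofReal (h0.mono_left nhdsWithin_le_nhds)) (Or.inr hv)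
  refine le_antisymm (ge_of_tendsto hcont ?_) zero_le
  filter_upwards [self_mem_nhdsWithin] with s hs
  rw [← volume_sublevel_of_pos hd hf hs]
  exact measure_mono fun x (hx : eval x f ≤ 0) => hx.trans (le_of_lt hs)

lemma eval_nonneg_of_sublevelVol_ne_top {n d : ℕ} (hn : n ≠ 0) (hd : d ≠ 0)
    {f : MvPolynomial (Fin n) ℝ} (hf : f.IsHomogeneous d) (hv : sublevelVol n f ≠ ⊤)
    (x : Fin n → ℝ) : 0 ≤ eval x f := by
  have hopen : IsOpen {x : Fin n → ℝ | eval x f < 0} :=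
    isOpen_lt (MvPolynomial.continuous_eval f) continuous_const
  have hempty := (hopen.measure_eq_zero_iff volume).1 <|
    measure_mono_null (fun y (hy : eval y f < 0) => hy.le) (volume_nonpos_eq_zero hn hd hf hv)
  exact not_lt.1 fun hx => hempty.subset hx

lemma volume_sublevel {n d : ℕ} (hn : n ≠ 0) (hd : d ≠ 0) {f : MvPolynomial (Fin n) ℝ}
    (hf : f.IsHomogeneous d) (hv : sublevelVol n f ≠ ⊤) (s : ℝ) :
    volume {x : Fin n → ℝ | eval x f ≤ s} =
      ENNReal.ofReal (max s 0 ^ ((n : ℝ) / d)) * sublevelVol n f := by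
  rcases lt_or_ge 0 s with hs | hs
  · rw [max_eq_left hs.le, volume_sublevel_of_pos hd hf hs]
  · have hexp : (n : ℝ) / d ≠ 0 := by positivity
    rw [max_eq_right hs, Real.zero_rpow hexp, ENNReal.ofReal_zero, zero_mul]
    exact measure_mono_null (fun x hx => le_trans hx hs) (volume_nonpos_eq_zero hn hd hf hv)

/-- The ratio `∫ (1 - f)⁺ / v(f)` shared by all forms of degree `d` with `v(f) < ∞`. -/
noncomputable def layerConst (n d : ℕ) : ENNReal :=
  ∫⁻ t in Set.Ioi (0 : ℝ), ENNReal.ofReal (max (1 - t) 0 ^ ((n : ℝ) / d))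

lemma layerConst_ne_zero (n d : ℕ) : layerConst n d ≠ 0 := by
  have hmeas : Measurable fun t : ℝ => ENNReal.ofReal (max (1 - t) 0 ^ ((n : ℝ) / d)) := by
    fun_prop
  rw [layerConst, ← pos_iff_ne_zero, setLIntegral_pos_iff hmeas]
  refine lt_of_lt_of_le ?_ (measure_mono (s := Set.Ioo 0 1) fun t ht => ⟨?_, ht.1⟩)
  · simp
  · have : 0 < max (1 - t) 0 := lt_max_of_lt_left (sub_pos.2 ht.2)
    exact (ENNReal.ofReal_pos.2 (Real.rpow_pos_of_pos this _)).ne'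

lemma layerConst_ne_top {n d : ℕ} (hn : n ≠ 0) (hd : d ≠ 0) : layerConst n d ≠ ⊤ := by
  have hexp : 0 < (n : ℝ) / d := by positivity
  refine ne_top_of_le_ne_top ENNReal.one_ne_top ?_
  calc layerConst n d ≤ ∫⁻ t in Set.Ioi (0 : ℝ), (Set.Iic 1).indicator 1 t := by
        refine setLIntegral_mono (measurable_one.indicator measurableSet_Iic) fun t ht => ?_
        by_cases h : t ≤ 1
        · rw [Set.indicator_of_mem (Set.mem_Iic.2 h), Pi.one_apply, ENNReal.ofReal_le_one]
          refine Real.rpow_le_one (le_max_right _ _) (max_le ?_ zero_le_one) hexp.le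
          linarith [Set.mem_Ioi.1 ht]
        · rw [max_eq_right (by linarith), Real.zero_rpow hexp.ne', ENNReal.ofReal_zero]
          exact zero_le
    _ = 1 := by
        rw [lintegral_indicator_one measurableSet_Iic, Measure.restrict_apply measurableSet_Iic,
          Set.Iic_inter_Ioi]
        simp

lemma max_one_sub_nonneg {n : ℕ} (f : MvPolynomial (Fin n) ℝ) :
    0 ≤ᵐ[volume] fun x : Fin n → ℝ => max (1 - eval x f) 0 :=
  ae_of_all _ fun _ => le_max_right _ _

lemma lintegral_max_one_sub {n d : ℕ} (hn : n ≠ 0) (hd : d ≠ 0) {f : MvPolynomial (Fin n) ℝ}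
    (hf : f.IsHomogeneous d) (hv : sublevelVol n f ≠ ⊤) :
    ∫⁻ x : Fin n → ℝ, ENNReal.ofReal (max (1 - eval x f) 0) =
      layerConst n d * sublevelVol n f := by
  have hcont := MvPolynomial.continuous_eval f
  rw [lintegral_eq_lintegral_meas_le _ (max_one_sub_nonneg f) (by fun_prop), layerConst,
    ← lintegral_mul_const _ (by fun_prop)]
  refine setLIntegral_congr_fun measurableSet_Ioi fun t ht => ?_
  rw [← volume_sublevel hn hd hf hv]
  congr 1 with x
  have ht' : ¬ t ≤ 0 := not_le.2 ht
  simp only [Set.mem_ofPred_eq, le_max_iff, ht', or_false]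
  constructor <;> intro h <;> linarith

lemma integrable_max_one_sub {n d : ℕ} (hn : n ≠ 0) (hd : d ≠ 0) {f : MvPolynomial (Fin n) ℝ}
    (hf : f.IsHomogeneous d) (hv : sublevelVol n f ≠ ⊤) :
    Integrable fun x : Fin n → ℝ => max (1 - eval x f) 0 := by
  have hcont := MvPolynomial.continuous_eval f
  refine (lintegral_ofReal_ne_top_iff_integrable (by fun_prop)
    (max_one_sub_nonneg f)).1 ?_
  rw [lintegral_max_one_sub hn hd hf hv]
  exact ENNReal.mul_ne_top (layerConst_ne_top hn hd) hv

lemma integral_max_one_sub {n d : ℕ} (hn : n ≠ 0) (hd : d ≠ 0) {f : MvPolynomial (Fin n) ℝ}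
    (hf : f.IsHomogeneous d) (hv : sublevelVol n f ≠ ⊤) :
    ∫ x : Fin n → ℝ, max (1 - eval x f) 0 =
      (layerConst n d).toReal * (sublevelVol n f).toReal := by
  have hcont := MvPolynomial.continuous_eval f
  rw [integral_eq_lintegral_of_nonneg_ae (max_one_sub_nonneg f) (by fun_prop),
    lintegral_max_one_sub hn hd hf hv, ENNReal.toReal_mul]

section Comparison

variable {n d : ℕ} {f g : MvPolynomial (Fin n) ℝ}

lemma indicator_one_sub_le (x : Fin n → ℝ) :
    {x | eval x g ≤ 1}.indicator (fun x => 1 - eval x f) x ≤ max (1 - eval x f) 0 :=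
  Set.indicator_le' (fun _ _ => le_max_left _ _) (fun _ _ => le_max_right _ _) x

lemma integral_max_le_integral_indicator (hE : IsCompact {x : Fin n → ℝ | eval x g ≤ 1})
    (hfg : ∫ x in {x : Fin n → ℝ | eval x g ≤ 1}, eval x f ≤
      ∫ x in {x : Fin n → ℝ | eval x g ≤ 1}, eval x g) :
    ∫ x : Fin n → ℝ, max (1 - eval x g) 0 ≤
      ∫ x : Fin n → ℝ, {x | eval x g ≤ 1}.indicator (fun x => 1 - eval x f) x := by
  have hg : (fun x : Fin n → ℝ => max (1 - eval x g) 0) =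
      {x | eval x g ≤ 1}.indicator fun x => 1 - eval x g := by
    ext x
    by_cases hx : eval x g ≤ 1
    · rw [Set.indicator_of_mem (by exact hx), max_eq_left (by linarith)]
    · rw [Set.indicator_of_notMem (by exact hx), max_eq_right (by linarith)]
  have hone : IntegrableOn (fun _ : Fin n → ℝ => (1 : ℝ)) {x | eval x g ≤ 1} :=
    continuousOn_const.integrableOn_compact hE
  rw [hg, integral_indicator hE.measurableSet, integral_indicator hE.measurableSet,
    integral_sub hone (integrableOn_eval hE f), integral_sub hone (integrableOn_eval hE g)]
  linarith

lemma integrable_indicator_one_sub (hE : IsCompact {x : Fin n → ℝ | eval x g ≤ 1}) :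
    Integrable ({x : Fin n → ℝ | eval x g ≤ 1}.indicator fun x => 1 - eval x f) := by
  have hcont := MvPolynomial.continuous_eval f
  have hcont' : Continuous fun x : Fin n → ℝ => 1 - eval x f := by fun_prop
  exact (hcont'.continuousOn.integrableOn_compact hE).integrable_indicator hE.measurableSet

lemma sublevelVol_le_of_setIntegral_le (hn : n ≠ 0) (hd : d ≠ 0)
    (hf : f.IsHomogeneous d) (hg : g.IsHomogeneous d) (hv : sublevelVol n f ≠ ⊤)
    (hE : IsCompact {x : Fin n → ℝ | eval x g ≤ 1})
    (hfg : ∫ x in {x : Fin n → ℝ | eval x g ≤ 1}, eval x f ≤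
      ∫ x in {x : Fin n → ℝ | eval x g ≤ 1}, eval x g) :
    sublevelVol n g ≤ sublevelVol n f := by
  have hvg : sublevelVol n g ≠ ⊤ := hE.measure_lt_top.ne
  have h := (integral_max_le_integral_indicator hE hfg).trans
    (integral_mono (integrable_indicator_one_sub hE) (integrable_max_one_sub hn hd hf hv)
      indicator_one_sub_le)
  rw [integral_max_one_sub hn hd hg hvg, integral_max_one_sub hn hd hf hv] at h
  have hK := ENNReal.toReal_pos (layerConst_ne_zero n d) (layerConst_ne_top hn hd)
  exact (ENNReal.toReal_le_toReal hvg hv).1 (le_of_mul_le_mul_left h hK)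

lemma eq_of_sublevelVol_eq (hn : n ≠ 0) (hd : d ≠ 0)
    (hf : f.IsHomogeneous d) (hg : g.IsHomogeneous d)
    (hE : IsCompact {x : Fin n → ℝ | eval x g ≤ 1}) (hgpos : ∀ x ≠ 0, 0 < eval x g)
    (hfg : ∫ x in {x : Fin n → ℝ | eval x g ≤ 1}, eval x f ≤
      ∫ x in {x : Fin n → ℝ | eval x g ≤ 1}, eval x g)
    (heq : sublevelVol n f = sublevelVol n g) : f = g := by
  have hvg : sublevelVol n g ≠ ⊤ := hE.measure_lt_top.ne
  have hv : sublevelVol n f ≠ ⊤ := heq ▸ hvg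
  have hcf := MvPolynomial.continuous_eval f
  have hcg := MvPolynomial.continuous_eval g
  have hint : ∫ x : Fin n → ℝ, max (1 - eval x f) 0 ≤
      ∫ x : Fin n → ℝ, {x | eval x g ≤ 1}.indicator (fun x => 1 - eval x f) x := by
    rw [integral_max_one_sub hn hd hf hv, heq, ← integral_max_one_sub hn hd hg hvg]
    exact integral_max_le_integral_indicator hE hfg
  have hae := (integral_eq_iff_of_ae_le (integrable_indicator_one_sub hE)
    (integrable_max_one_sub hn hd hf hv) (ae_of_all _ indicator_one_sub_le)).1
    (le_antisymm (integral_mono (integrable_indicator_one_sub hE)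
      (integrable_max_one_sub hn hd hf hv) indicator_one_sub_le) hint)
  have hnull : volume {x : Fin n → ℝ | ¬ {x | eval x g ≤ 1}.indicator (fun x => 1 - eval x f) x =
      max (1 - eval x f) 0} = 0 := ae_iff.1 hae
  have hin (x : Fin n → ℝ) (hx : eval x g < 1) : eval x f ≤ 1 := by
    have hopen : IsOpen {x : Fin n → ℝ | eval x g < 1 ∧ 1 < eval x f} :=
      (isOpen_lt hcg continuous_const).inter (isOpen_lt continuous_const hcf)
    have hempty := (hopen.measure_eq_zero_iff volume).1 <| measure_mono_null
      (fun y (hy : eval y g < 1 ∧ 1 < eval y f) => Set.mem_ofPred.2 fun h => by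
        rw [Set.indicator_of_mem (by exact hy.1.le), max_eq_right (by linarith)] at h
        linarith) hnull
    exact not_lt.1 fun h => hempty.subset ⟨hx, h⟩
  have hout (x : Fin n → ℝ) (hx : 1 < eval x g) : 1 ≤ eval x f := by
    have hopen : IsOpen {x : Fin n → ℝ | 1 < eval x g ∧ eval x f < 1} :=
      (isOpen_lt continuous_const hcg).inter (isOpen_lt hcf continuous_const)
    have hempty := (hopen.measure_eq_zero_iff volume).1 <| measure_mono_null
      (fun y (hy : 1 < eval y g ∧ eval y f < 1) => Set.mem_ofPred.2 fun h => by
        rw [Set.indicator_of_notMem (by exact hy.1.not_ge), max_eq_left (by linarith)] at h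
        linarith) hnull
    exact not_lt.1 fun h => hempty.subset ⟨hx, h⟩
  refine MvPolynomial.funext fun x => ?_
  rcases eq_or_ne x 0 with rfl | hx
  · have h0 {p : MvPolynomial (Fin n) ℝ} (hp : p.IsHomogeneous d) : eval 0 p = 0 := by
      have := eval_smul_of_isHomogeneous hp 0 0
      rwa [smul_zero, zero_pow hd, zero_mul] at this
    rw [h0 hf, h0 hg]
  have hgx := hgpos x hx
  have hfx := eval_nonneg_of_sublevelVol_ne_top hn hd hf hv x
  have hsum : 0 < eval x f + eval x g := by linarith
  set r := 2 / (eval x f + eval x g) with hr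
  have hrd : (r ^ (d : ℝ)⁻¹) ^ d = r := Real.rpow_inv_natCast_pow (by positivity) hd
  have hinr := hin (r ^ (d : ℝ)⁻¹ • x)
  have houtr := hout (r ^ (d : ℝ)⁻¹ • x)
  rw [eval_smul_of_isHomogeneous hf, eval_smul_of_isHomogeneous hg, hrd, hr, div_mul_eq_mul_div,
    div_mul_eq_mul_div] at hinr houtr
  rw [div_lt_one hsum, div_le_one hsum] at hinr
  rw [one_lt_div hsum, one_le_div hsum] at houtr
  by_contra hne
  rcases lt_or_gt_of_ne hne with h | h
  · linarith [houtr (by linarith)]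
  · linarith [hinr (by linarith)]

end Comparison

lemma sublevelVol_ballForm {n d : ℕ} (hn : n ≠ 0) (hd : d / 2 ≠ 0) :
    sublevelVol n (ballForm n d) = ENNReal.ofReal (unitBallVol n) := by
  have : Nonempty (Fin n) := ⟨⟨0, Nat.pos_of_ne_zero hn⟩⟩
  have hset : {x : Fin n → ℝ | eval x (ballForm n d) ≤ 1} =
      WithLp.toLp 2 ⁻¹' Metric.closedBall (0 : EuclideanSpace ℝ (Fin n)) 1 := by
    ext x
    simp only [Set.mem_ofPred_eq, eval_ballForm, Set.mem_preimage,
      EuclideanSpace.closedBall_zero_eq _ zero_le_one, one_pow]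
    exact pow_le_one_iff_of_nonneg (Finset.sum_nonneg fun i _ => sq_nonneg _) hd
  rw [sublevelVol, hset, (PiLp.volume_preserving_toLp (Fin n)).measure_preimage
    Metric.isClosed_closedBall.measurableSet.nullMeasurableSet, EuclideanSpace.volume_closedBall,
    unitBallVol, Real.sqrt_eq_rpow, ← Real.rpow_natCast, ← Real.rpow_mul Real.pi_pos.le]
  simp [div_eq_inv_mul]

section BallForm

variable {n d : ℕ} {t : ℝ}

lemma eval_smul_ballForm_le_one (ht : 0 < t) (x : Fin n → ℝ) :
    eval x (t⁻¹ • ballForm n d) ≤ 1 ↔ eval x (ballForm n d) ≤ t := by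
  rw [smul_eval, inv_mul_le_one₀ ht]

lemma eval_ballForm_pos {x : Fin n → ℝ} (hx : x ≠ 0) : 0 < eval x (ballForm n d) := by
  rw [eval_ballForm]
  obtain ⟨i, hi⟩ := Function.ne_iff.1 hx
  exact pow_pos (Finset.sum_pos' (fun i _ => sq_nonneg _)
    ⟨i, Finset.mem_univ i, sq_pos_of_ne_zero hi⟩) _

lemma isCompact_ballForm_le (hd : d / 2 ≠ 0) :
    IsCompact {x : Fin n → ℝ | eval x (ballForm n d) ≤ t} := by
  refine Metric.isCompact_of_isClosed_isBounded
    (isClosed_le (MvPolynomial.continuous_eval _) continuous_const)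
    ((Metric.isBounded_closedBall (x := 0) (r := 1 + |t|)).subset fun x hx => ?_)
  rw [Set.mem_ofPred_eq, eval_ballForm] at hx
  have hsum : ∑ i, x i ^ 2 ≤ 1 + |t| := by
    by_contra! h
    have h1 := le_self_pow₀ (by linarith [abs_nonneg t] : 1 ≤ ∑ i, x i ^ 2) hd
    linarith [le_abs_self t]
  rw [mem_closedBall_zero_iff, pi_norm_le_iff_of_nonneg (by positivity)]
  intro i
  have hi : x i ^ 2 ≤ ∑ i, x i ^ 2 :=
    Finset.single_le_sum (f := fun i => x i ^ 2) (fun i _ => sq_nonneg _) (Finset.mem_univ i)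
  exact abs_le_of_sq_le_sq (by nlinarith [abs_nonneg t]) (by positivity)

lemma interior_ballForm_le_nonempty (hd : d / 2 ≠ 0) (ht : 0 < t) :
    (interior {x : Fin n → ℝ | eval x (ballForm n d) ≤ t}).Nonempty := by
  have hopen : IsOpen {x : Fin n → ℝ | eval x (ballForm n d) < t} :=
    isOpen_lt (MvPolynomial.continuous_eval _) continuous_const
  have hsub : {x : Fin n → ℝ | eval x (ballForm n d) < t} ⊆
      {x | eval x (ballForm n d) ≤ t} := fun x (hx : eval x _ < t) => hx.le
  refine ⟨0, interior_maximal hsub hopen ?_⟩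
  simpa [eval_ballForm, zero_pow hd] using ht

lemma eval_mulVec_ballForm {A : Matrix (Fin n) (Fin n) ℝ} (hA : A * Aᵀ = 1) (x : Fin n → ℝ) :
    eval (A *ᵥ x) (ballForm n d) = eval x (ballForm n d) := by
  have h (y : Fin n → ℝ) : ∑ i, y i ^ 2 = y ⬝ᵥ y := by simp [dotProduct, sq]
  rw [eval_ballForm, eval_ballForm, h, h, dotProduct_mulVec, ← mulVec_transpose, mulVec_mulVec,
    mul_eq_one_comm.1 hA, one_mulVec]

end BallForm

/-- For an `O(n)`-invariant norm `‖·‖` on degree-`d` forms, every form `f` of degree `d` with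
`‖f‖ ≤ 1` satisfies `v(f) ≥ ‖b_{d,n}‖^{n/d} · π^{n/2}/Γ(n/2+1)`, with equality iff
`f = b_{d,n}/‖b_{d,n}‖`. -/
theorem stmt1 (n d : ℕ) (hn : 1 ≤ n) (hd : 2 ≤ d) (hdeven : Even d)
    (Nm : MvPolynomial (Fin n) ℝ → ℝ)
    (Nm_add : ∀ f g : MvPolynomial (Fin n) ℝ, f.IsHomogeneous d → g.IsHomogeneous d →
      Nm (f + g) ≤ Nm f + Nm g)
    (Nm_smul : ∀ (c : ℝ) (f : MvPolynomial (Fin n) ℝ), f.IsHomogeneous d →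
      Nm (c • f) = |c| * Nm f)
    (Nm_eq_zero : ∀ f : MvPolynomial (Fin n) ℝ, f.IsHomogeneous d → (Nm f = 0 ↔ f = 0))
    (Nm_inv : ∀ ρ : Matrix (Fin n) (Fin n) ℝ, ρ * ρᵀ = 1 →
      ∀ f : MvPolynomial (Fin n) ℝ, f.IsHomogeneous d → Nm (rotate n ρ f) = Nm f) :
    ∀ f : MvPolynomial (Fin n) ℝ, f.IsHomogeneous d → Nm f ≤ 1 →
      ENNReal.ofReal ((Nm (ballForm n d)) ^ ((n : ℝ) / d) * unitBallVol n) ≤ sublevelVol n f ∧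
      (sublevelVol n f
          = ENNReal.ofReal ((Nm (ballForm n d)) ^ ((n : ℝ) / d) * unitBallVol n) ↔
        f = (Nm (ballForm n d))⁻¹ • ballForm n d) := by
  intro f hf hfN
  have hn0 : n ≠ 0 := by omega
  have hd0 : d ≠ 0 := by omega
  have hd2 : d / 2 ≠ 0 := by omega
  have hb := isHomogeneous_ballForm n hdeven
  have hNm_nonneg (p : MvPolynomial (Fin n) ℝ) (hp : p.IsHomogeneous d) : 0 ≤ Nm p := by
    have h1 := Nm_add p ((-1 : ℝ) • p) hp ((homogeneousSubmodule (Fin n) ℝ d).smul_mem _ hp)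
    have h2 := Nm_smul 0 p hp
    rw [Nm_smul _ _ hp, neg_one_smul, add_neg_cancel, ← zero_smul ℝ p, h2] at h1
    norm_num at h1
    exact h1
  have hb0 : ballForm n d ≠ 0 := fun h => by
    have := eval_ballForm_pos (d := d) (x := fun _ : Fin n => (1 : ℝ))
      (Function.ne_iff.2 ⟨⟨0, hn⟩, one_ne_zero⟩)
    simp [h] at this
  have ht : 0 < Nm (ballForm n d) :=
    (hNm_nonneg _ hb).lt_of_ne' fun h => hb0 ((Nm_eq_zero _ hb).1 h)
  set t := Nm (ballForm n d) with ht_def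
  set g := t⁻¹ • ballForm n d with hg_def
  have hg : g.IsHomogeneous d := (homogeneousSubmodule (Fin n) ℝ d).smul_mem _ hb
  have hset : {x : Fin n → ℝ | eval x g ≤ 1} = {x | eval x (ballForm n d) ≤ t} := by
    ext x
    exact eval_smul_ballForm_le_one ht x
  have hE : IsCompact {x : Fin n → ℝ | eval x g ≤ 1} := hset ▸ isCompact_ballForm_le hd2
  have hvg : sublevelVol n g = ENNReal.ofReal (t ^ ((n : ℝ) / d) * unitBallVol n) := by
    rw [sublevelVol, hset, volume_sublevel_of_pos hd0 hb ht, sublevelVol_ballForm hn0 hd2,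
      ← ENNReal.ofReal_mul (by positivity)]
  have hgpos (x : Fin n → ℝ) (hx : x ≠ 0) : 0 < eval x g := by
    rw [hg_def, smul_eval]
    exact mul_pos (inv_pos.2 ht) (eval_ballForm_pos hx)
  have hfg : ∫ x in {x : Fin n → ℝ | eval x g ≤ 1}, eval x f ≤
      ∫ x in {x : Fin n → ℝ | eval x g ≤ 1}, eval x g := by
    obtain ⟨c, hcN, hcI⟩ := exists_smul_ballForm_average hn hdeven Nm_add Nm_smul Nm_inv hE
      (hset ▸ interior_ballForm_le_nonempty hd2 ht)
      (fun A hA x => by simp only [hset, Set.mem_ofPred_eq, eval_mulVec_ballForm hA]) hf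
    rw [Nm_smul _ _ hb] at hcN
    have hc : c ≤ t⁻¹ := by
      rw [← one_div, le_div_iff₀ ht]
      exact (mul_le_mul_of_nonneg_right (le_abs_self c) ht.le).trans (hcN.trans hfN)
    rw [← hcI]
    refine setIntegral_mono (integrableOn_eval hE _) (integrableOn_eval hE _) fun x => ?_
    simp only [hg_def, smul_eval]
    refine mul_le_mul_of_nonneg_right hc ?_
    rw [eval_ballForm]
    positivity
  rw [← hvg]
  refine ⟨?_, fun heq => eq_of_sublevelVol_eq hn0 hd0 hf hg hE hgpos hfg heq, fun h => by rw [h]⟩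
  rcases eq_or_ne (sublevelVol n f) ⊤ with hv | hv
  · exact hv ▸ le_top
  · exact sublevelVol_le_of_setIntegral_le hn0 hd0 hf hg hv hE hfg
end

section
/- Let n ≥ 1, let d ≥ 2 be even, set N = binom(d/2 + n − 1, n − 1), and let ‖·‖ be any norm on the space S_N of real symmetric N×N matrices. Then the problem of minimizing v(f) over all sums of squares f ∈ F_{d,n} of the form f(x) = m_{d/2}(x)ᵗ G m_{d/2}(x) with G positive semidefinite and ‖G‖ ≤ 1 is a convex optimization problem having a unique optimal solution f*_{sos} ∈ F_{d,n}. -/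
open MvPolynomial MeasureTheory Real Finset Matrix

/-- `μ` enumerates (with respect to some fixed total order) the multi-indices
`α` of degree `k` in `n` variables. -/
def IsMonomialEnum (n k : ℕ) {N : ℕ} (μ : Fin N → (Fin n →₀ ℕ)) : Prop :=
  Function.Injective μ ∧ (∀ i, ∑ j, μ i j = k) ∧
    ∀ α : Fin n →₀ ℕ, (∑ j, α j) = k → ∃ i, μ i = α

/-- The `i`-th rescaled monomial `√(k choose α) x^α` (with `α = μ i`) as a polynomial,
i.e. the `i`-th entry of the vector `m_k(x)`. -/
noncomputable def mPoly (n : ℕ) {N : ℕ} (μ : Fin N → (Fin n →₀ ℕ)) (i : Fin N) :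
    MvPolynomial (Fin n) ℝ :=
  C (Real.sqrt ((μ i).multinomial)) * monomial (μ i) 1

/-- The form `f(x) = m_k(x)ᵗ G m_k(x)` associated with a matrix `G`. -/
noncomputable def gramForm (n : ℕ) {N : ℕ} (μ : Fin N → (Fin n →₀ ℕ))
    (G : Matrix (Fin N) (Fin N) ℝ) : MvPolynomial (Fin n) ℝ :=
  ∑ i, ∑ j, C (G i j) * mPoly n μ i * mPoly n μ j

open scoped Pointwise in
/-- The volume of the sublevel set at a positive level of a positively homogeneous function
is a power of the level times the volume of the unit sublevel set. -/
theorem volume_sublevel_of_homogeneous {n d : ℕ} (hd : d ≠ 0) {f : (Fin n → ℝ) → ℝ}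
    (hf : ∀ s : ℝ, 0 < s → ∀ x, f (s • x) = s ^ d * f x) {t : ℝ} (ht : 0 < t) :
    volume {x | f x ≤ t} = ENNReal.ofReal (t ^ ((n : ℝ) / d)) * volume {x | f x ≤ 1} := by
  have hs : 0 < t ^ ((d : ℝ)⁻¹) := Real.rpow_pos_of_pos ht _
  have hsd : (t ^ ((d : ℝ)⁻¹)) ^ d = t := Real.rpow_inv_natCast_pow ht.le hd
  have hset : {x | f x ≤ t} = (t ^ ((d : ℝ)⁻¹)) • ({x | f x ≤ 1} : Set (Fin n → ℝ)) := by
    ext x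
    rw [Set.mem_smul_set_iff_inv_smul_mem₀ hs.ne']
    rw [Set.mem_ofPred_eq, Set.mem_ofPred_eq, hf _ (inv_pos.2 hs), inv_pow, hsd, inv_mul_le_iff₀ ht, mul_one]
  rw [hset, Measure.addHaar_smul, Module.finrank_fin_fun, abs_of_pos (pow_pos hs n),
    ← Real.rpow_natCast, ← Real.rpow_mul ht.le, inv_mul_eq_div]

theorem lintegral_Ici_exp_neg (a : ℝ) :
    ∫⁻ t in Set.Ici a, ENNReal.ofReal (Real.exp (-t)) = ENNReal.ofReal (Real.exp (-a)) := by
  rw [setLIntegral_congr Ioi_ae_eq_Ici.symm, ← integral_exp_neg_Ioi a,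
    ofReal_integral_eq_lintegral_ofReal (integrableOn_exp_neg_Ioi a)
      (Filter.Eventually.of_forall fun t => (Real.exp_pos _).le)]

theorem lintegral_Ioi_exp_neg_mul_rpow {a : ℝ} (ha : 0 ≤ a) :
    ∫⁻ t in Set.Ioi 0, ENNReal.ofReal (Real.exp (-t)) * ENNReal.ofReal (t ^ a)
      = ENNReal.ofReal (Real.Gamma (a + 1)) := by
  have ha' : 0 < a + 1 := by linarith
  rw [Real.Gamma_eq_integral ha', ofReal_integral_eq_lintegral_ofReal
    (Real.GammaIntegral_convergent ha')]
  · refine setLIntegral_congr_fun measurableSet_Ioi fun t _ => ?_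
    simp only [add_sub_cancel_right]
    rw [ENNReal.ofReal_mul (Real.exp_pos _).le]
  · filter_upwards [ae_restrict_mem measurableSet_Ioi] with t ht
    exact mul_nonneg (Real.exp_pos _).le (Real.rpow_nonneg (le_of_lt ht) _)

/-- The Laplace-type formula `∫ exp(-f) = Γ(1 + n/d) · vol {f ≤ 1}` for a nonnegative positively
homogeneous function of degree `d` on `ℝⁿ`. -/
theorem lintegral_exp_neg_of_homogeneous {n d : ℕ} (hd : d ≠ 0) {f : (Fin n → ℝ) → ℝ}
    (hmeas : Measurable f) (hnonneg : ∀ x, 0 ≤ f x)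
    (hf : ∀ s : ℝ, 0 < s → ∀ x, f (s • x) = s ^ d * f x) :
    ∫⁻ x, ENNReal.ofReal (Real.exp (-f x))
      = ENNReal.ofReal (Real.Gamma ((n : ℝ) / d + 1)) * volume {x | f x ≤ 1} := by
  have hset : MeasurableSet {p : (Fin n → ℝ) × ℝ | f p.1 ≤ p.2} :=
    measurableSet_le (hmeas.comp measurable_fst) measurable_snd
  have hexp : Measurable fun t : ℝ => ENNReal.ofReal (Real.exp (-t)) := by fun_prop
  calc ∫⁻ x, ENNReal.ofReal (Real.exp (-f x))
      = ∫⁻ x, ∫⁻ t in Set.Ioi (0 : ℝ),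
          {p : (Fin n → ℝ) × ℝ | f p.1 ≤ p.2}.indicator
            (fun p => ENNReal.ofReal (Real.exp (-p.2))) (x, t) := by
        refine lintegral_congr fun x => ?_
        rw [← lintegral_Ici_exp_neg, ← setLIntegral_congr (Ioi_ae_eq_Ici (a := (0 : ℝ))).symm,
          ← lintegral_indicator measurableSet_Ici, ← lintegral_indicator measurableSet_Ici]
        refine lintegral_congr fun t => ?_
        have := hnonneg x
        by_cases h : f x ≤ t
        · simp [Set.indicator, h, this.trans h]
        · simp [Set.indicator, h]
    _ = ∫⁻ t in Set.Ioi (0 : ℝ), ∫⁻ x,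
          {p : (Fin n → ℝ) × ℝ | f p.1 ≤ p.2}.indicator
            (fun p => ENNReal.ofReal (Real.exp (-p.2))) (x, t) := by
        refine lintegral_lintegral_swap (Measurable.aemeasurable ?_)
        exact (hexp.comp measurable_snd).indicator hset
    _ = ∫⁻ t in Set.Ioi (0 : ℝ), ENNReal.ofReal (Real.exp (-t)) *
          ENNReal.ofReal (t ^ ((n : ℝ) / d)) * volume {x | f x ≤ 1} := by
        refine setLIntegral_congr_fun measurableSet_Ioi fun t ht => ?_
        have h1 : ∀ x, {p : (Fin n → ℝ) × ℝ | f p.1 ≤ p.2}.indicator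
            (fun p => ENNReal.ofReal (Real.exp (-p.2))) (x, t)
            = {x | f x ≤ t}.indicator (fun _ => ENNReal.ofReal (Real.exp (-t))) x := fun x => by
          simp [Set.indicator]
        simp only [h1]
        rw [lintegral_indicator_const (measurableSet_le hmeas measurable_const),
          volume_sublevel_of_homogeneous hd hf ht, mul_assoc]
    _ = _ := by
        rw [lintegral_mul_const _ (by fun_prop), lintegral_Ioi_exp_neg_mul_rpow (by positivity)]

/-- By strict convexity of `exp`, if `∫ exp(-f)` and `∫ exp(-g)` are equal, finite, and
at most `∫ exp(-(f + g) / 2)`, then `f = g`. -/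
theorem eq_of_lintegral_exp_neg_le_midpoint {n : ℕ} {f g : (Fin n → ℝ) → ℝ}
    (hf : Continuous f) (hg : Continuous g)
    (hfin : ∫⁻ x, ENNReal.ofReal (Real.exp (-f x)) ≠ ⊤)
    (hfg : ∫⁻ x, ENNReal.ofReal (Real.exp (-g x)) = ∫⁻ x, ENNReal.ofReal (Real.exp (-f x)))
    (hmid : ∫⁻ x, ENNReal.ofReal (Real.exp (-f x))
      ≤ ∫⁻ x, ENNReal.ofReal (Real.exp (-((f x + g x) / 2)))) : f = g := by
  have hsq : ∀ a b : ℝ, (Real.exp (-a) + Real.exp (-b)) / 2 - Real.exp (-((a + b) / 2))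
      = (Real.exp (-a / 2) - Real.exp (-b / 2)) ^ 2 / 2 := fun a b => by
    have h1 : Real.exp (-a) = Real.exp (-a / 2) ^ 2 := by
      rw [sq, ← Real.exp_add]; ring_nf
    have h2 : Real.exp (-b) = Real.exp (-b / 2) ^ 2 := by
      rw [sq, ← Real.exp_add]; ring_nf
    have h3 : Real.exp (-((a + b) / 2)) = Real.exp (-a / 2) * Real.exp (-b / 2) := by
      rw [← Real.exp_add]; ring_nf
    rw [h1, h2, h3]; ring
  have hle : ∀ a b : ℝ, Real.exp (-((a + b) / 2)) ≤ (Real.exp (-a) + Real.exp (-b)) / 2 :=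
    fun a b => by
      have := hsq a b
      nlinarith [sq_nonneg (Real.exp (-a / 2) - Real.exp (-b / 2))]
  have havg : ∫⁻ x, ENNReal.ofReal ((Real.exp (-f x) + Real.exp (-g x)) / 2)
      = ∫⁻ x, ENNReal.ofReal (Real.exp (-f x)) := by
    have h1 : ∀ x, ENNReal.ofReal ((Real.exp (-f x) + Real.exp (-g x)) / 2)
        = (ENNReal.ofReal (Real.exp (-f x)) + ENNReal.ofReal (Real.exp (-g x))) / 2 := fun x => by
      rw [ENNReal.ofReal_div_of_pos two_pos,
        ENNReal.ofReal_add (Real.exp_pos _).le (Real.exp_pos _).le, ENNReal.ofReal_ofNat]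
    simp only [h1]
    simp only [div_eq_mul_inv]
    rw [lintegral_mul_const _ (by fun_prop), lintegral_add_left (by fun_prop), hfg,
      ← div_eq_mul_inv, ENNReal.add_div, ENNReal.add_halves]
  have hle' : ∀ x, ENNReal.ofReal (Real.exp (-((f x + g x) / 2)))
      ≤ ENNReal.ofReal ((Real.exp (-f x) + Real.exp (-g x)) / 2) :=
    fun x => ENNReal.ofReal_le_ofReal (hle _ _)
  have hae := ae_eq_of_ae_le_of_lintegral_le (μ := volume) (Filter.Eventually.of_forall hle')
    (ne_top_of_le_ne_top (havg ▸ hfin) (lintegral_mono hle'))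
    (by fun_prop) (havg.le.trans hmid)
  have heq := (Continuous.ae_eq_iff_eq volume
    (ENNReal.continuous_ofReal.comp (by fun_prop))
    (ENNReal.continuous_ofReal.comp (by fun_prop))).1 hae
  funext x
  have hx := congrFun heq x
  rw [Function.comp_apply, Function.comp_apply,
    ENNReal.ofReal_eq_ofReal_iff (Real.exp_pos _).le
    (div_pos (add_pos (Real.exp_pos _) (Real.exp_pos _)) two_pos).le] at hx
  have h0 : Real.exp (-f x / 2) = Real.exp (-g x / 2) := by
    have := hsq (f x) (g x)
    have h2 : (Real.exp (-f x / 2) - Real.exp (-g x / 2)) ^ 2 = 0 := by linarith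
    exact sub_eq_zero.1 (pow_eq_zero_iff two_ne_zero |>.1 h2)
  have := Real.exp_injective h0
  linarith

/-- A linear family of forms of positive degree, nonnegative over a compact convex parameter set
in a finite-dimensional space, has a unique member with smallest sublevel volume, provided
one of these volumes is finite. -/
theorem existsUnique_min_sublevelVol {E : Type*} [NormedAddCommGroup E] [NormedSpace ℝ E]
    [FiniteDimensional ℝ E] {n d : ℕ} (hd : d ≠ 0) {K : Set E} (hK : IsCompact K)
    (hconv : Convex ℝ K) (Φ : E →ₗ[ℝ] MvPolynomial (Fin n) ℝ)
    (hhom : ∀ G, ∀ s : ℝ, 0 < s → ∀ x, eval (s • x) (Φ G) = s ^ d * eval x (Φ G))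
    (hnonneg : ∀ G ∈ K, ∀ x, 0 ≤ eval x (Φ G))
    (hfin : ∃ G ∈ K, sublevelVol n (Φ G) ≠ ⊤) :
    ∃! f, (∃ G ∈ K, f = Φ G) ∧ ∀ G ∈ K, sublevelVol n f ≤ sublevelVol n (Φ G) := by
  have hcont : ∀ p : MvPolynomial (Fin n) ℝ, Continuous fun x => eval x p :=
    fun p => MvPolynomial.continuous_eval p
  have hΓ : 0 < Real.Gamma ((n : ℝ) / d + 1) := Real.Gamma_pos_of_pos (by positivity)
  have hI : ∀ G ∈ K, ∫⁻ x, ENNReal.ofReal (Real.exp (-eval x (Φ G)))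
      = ENNReal.ofReal (Real.Gamma ((n : ℝ) / d + 1)) * sublevelVol n (Φ G) := fun G hG =>
    lintegral_exp_neg_of_homogeneous hd (hcont _).measurable (hnonneg G hG) (hhom G)
  have hIle : ∀ G ∈ K, ∀ H ∈ K, (sublevelVol n (Φ G) ≤ sublevelVol n (Φ H) ↔
      ∫⁻ x, ENNReal.ofReal (Real.exp (-eval x (Φ G)))
        ≤ ∫⁻ x, ENNReal.ofReal (Real.exp (-eval x (Φ H)))) := fun G hG H hH => by
    rw [hI G hG, hI H hH, ENNReal.mul_le_mul_iff_right (by simpa using hΓ) ENNReal.ofReal_ne_top]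
  have hlsc : LowerSemicontinuous fun G : E =>
      ∫⁻ x, ENNReal.ofReal (Real.exp (-eval x (Φ G))) := by
    rw [lowerSemicontinuous_iff_le_liminf]
    intro G
    refine le_trans (le_of_eq ?_) (lintegral_liminf_le fun H => ?_)
    · refine lintegral_congr fun x => ?_
      have hlin : Continuous fun H : E => eval x (Φ H) :=
        LinearMap.continuous_of_finiteDimensional
          ((MvPolynomial.aeval x : MvPolynomial (Fin n) ℝ →ₐ[ℝ] ℝ).toLinearMap ∘ₗ Φ)
      have : Continuous fun H : E => ENNReal.ofReal (Real.exp (-eval x (Φ H))) :=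
        ENNReal.continuous_ofReal.comp (by fun_prop)
      exact (this.tendsto G).liminf_eq.symm
    · have := hcont (Φ H)
      exact Continuous.measurable (ENNReal.continuous_ofReal.comp (by fun_prop))
  obtain ⟨G₀, hG₀, hG₀fin⟩ := hfin
  obtain ⟨G, hG, hmin⟩ := (hlsc.lowerSemicontinuousOn K).exists_isMinOn ⟨G₀, hG₀⟩ hK
  have hmin' : ∀ H ∈ K, sublevelVol n (Φ G) ≤ sublevelVol n (Φ H) :=
    fun H hH => (hIle G hG H hH).2 (hmin hH)
  refine ⟨Φ G, ⟨⟨G, hG, rfl⟩, hmin'⟩, ?_⟩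
  rintro _ ⟨⟨H, hH, rfl⟩, hHmin⟩
  have hM : (2⁻¹ : ℝ) • H + (2⁻¹ : ℝ) • G ∈ K :=
    hconv hH hG (by norm_num) (by norm_num) (by norm_num)
  have heval : ∀ x, eval x (Φ ((2⁻¹ : ℝ) • H + (2⁻¹ : ℝ) • G))
      = (eval x (Φ H) + eval x (Φ G)) / 2 := fun x => by
    simp only [map_add, map_smul, smul_eval]; ring
  refine MvPolynomial.funext fun x => congrFun
    (eq_of_lintegral_exp_neg_le_midpoint (hcont (Φ H)) (hcont (Φ G)) ?_ ?_ ?_) x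
  · rw [hI H hH]
    exact ENNReal.mul_ne_top ENNReal.ofReal_ne_top (ne_top_of_le_ne_top hG₀fin (hHmin G₀ hG₀))
  · exact le_antisymm (hmin hH) ((hIle H hH G hG).1 (hHmin G hG))
  · simpa only [heval] using (hIle H hH _ hM).1 (hHmin _ hM)

/-- The intersection of the unit ball of a norm on a finite-dimensional space with half-spaces
`{0 ≤ L i}` is convex, and over it a linear family of nonnegative forms of positive degree has a
unique member with smallest sublevel volume, provided one of these volumes is finite. -/
theorem convex_and_existsUnique_min_sublevelVol_ball {E ι : Type*} [AddCommGroup E] [Module ℝ E]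
    [FiniteDimensional ℝ E] {n d : ℕ} (hd : d ≠ 0) [Norm E] (core : NormedSpace.Core ℝ E)
    (L : ι → E →ₗ[ℝ] ℝ) (Φ : E →ₗ[ℝ] MvPolynomial (Fin n) ℝ)
    (hhom : ∀ G, ∀ s : ℝ, 0 < s → ∀ x, eval (s • x) (Φ G) = s ^ d * eval x (Φ G))
    (hnonneg : ∀ G, (∀ i, 0 ≤ L i G) → ∀ x, 0 ≤ eval x (Φ G))
    (hfin : ∃ G, ((∀ i, 0 ≤ L i G) ∧ ‖G‖ ≤ 1) ∧ sublevelVol n (Φ G) ≠ ⊤) :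
    Convex ℝ {G | (∀ i, 0 ≤ L i G) ∧ ‖G‖ ≤ 1} ∧
    ∃! f, (∃ G ∈ {G | (∀ i, 0 ≤ L i G) ∧ ‖G‖ ≤ 1}, f = Φ G) ∧
      ∀ G ∈ {G | (∀ i, 0 ≤ L i G) ∧ ‖G‖ ≤ 1}, sublevelVol n f ≤ sublevelVol n (Φ G) := by
  let _ : NormedAddCommGroup E := NormedAddCommGroup.ofCore core
  let _ : NormedSpace ℝ E := NormedSpace.ofCore core
  have : ProperSpace E := FiniteDimensional.proper ℝ E
  have hset : {G : E | (∀ i, 0 ≤ L i G) ∧ ‖G‖ ≤ 1}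
      = Metric.closedBall 0 1 ∩ ⋂ i, {G | 0 ≤ L i G} := by
    ext G
    rw [Set.mem_inter_iff, mem_closedBall_zero_iff, Set.mem_iInter, and_comm]
    rfl
  have hconv : Convex ℝ {G : E | (∀ i, 0 ≤ L i G) ∧ ‖G‖ ≤ 1} := by
    rw [hset]
    exact (convex_closedBall 0 1).inter (convex_iInter fun i => convex_halfSpace_ge (L i).isLinear 0)
  have hcomp : IsCompact {G : E | (∀ i, 0 ≤ L i G) ∧ ‖G‖ ≤ 1} := by
    rw [hset]
    exact (isCompact_closedBall 0 1).inter_right (isClosed_iInter fun i =>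
      isClosed_le continuous_const (L i).continuous_of_finiteDimensional)
  exact ⟨hconv, existsUnique_min_sublevelVol hd hcomp hconv Φ hhom (fun G hG => hnonneg G hG.1)
    (by simpa using hfin)⟩

theorem eval_gramForm {n N : ℕ} (μ : Fin N → (Fin n →₀ ℕ)) (G : Matrix (Fin N) (Fin N) ℝ)
    (x : Fin n → ℝ) :
    eval x (gramForm n μ G)
      = (fun i => eval x (mPoly n μ i)) ⬝ᵥ G *ᵥ fun i => eval x (mPoly n μ i) := by
  simp only [gramForm, map_sum, map_mul, eval_C, dotProduct, mulVec, Finset.mul_sum]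
  exact Finset.sum_congr rfl fun i _ => Finset.sum_congr rfl fun j _ => by ring

theorem eval_mPoly {n N : ℕ} (μ : Fin N → (Fin n →₀ ℕ)) (i : Fin N) (x : Fin n → ℝ) :
    eval x (mPoly n μ i) = Real.sqrt ((μ i).multinomial) * ∏ j, x j ^ μ i j := by
  simp [mPoly, eval_monomial, Finsupp.prod_fintype]

theorem eval_smul_mPoly {n N k : ℕ} {μ : Fin N → (Fin n →₀ ℕ)} {i : Fin N}
    (hi : ∑ j, μ i j = k) (s : ℝ) (x : Fin n → ℝ) :
    eval (s • x) (mPoly n μ i) = s ^ k * eval x (mPoly n μ i) := by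
  simp only [eval_mPoly, Pi.smul_apply, smul_eq_mul, mul_pow, Finset.prod_mul_distrib,
    Finset.prod_pow_eq_pow_sum, hi]
  ring

theorem eval_smul_gramForm {n N k : ℕ} {μ : Fin N → (Fin n →₀ ℕ)}
    (hμ : ∀ i, ∑ j, μ i j = k) (G : Matrix (Fin N) (Fin N) ℝ) (s : ℝ) (x : Fin n → ℝ) :
    eval (s • x) (gramForm n μ G) = s ^ (k + k) * eval x (gramForm n μ G) := by
  have h : (fun i => eval (s • x) (mPoly n μ i)) = s ^ k • fun i => eval x (mPoly n μ i) := by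
    funext i
    simp [eval_smul_mPoly (hμ i)]
  rw [eval_gramForm, eval_gramForm, h, mulVec_smul, smul_dotProduct, dotProduct_smul,
    smul_eq_mul, smul_eq_mul, pow_add, mul_assoc]

/-- `gramForm` as a linear map. -/
noncomputable def gramLinear (n : ℕ) {N : ℕ} (μ : Fin N → (Fin n →₀ ℕ)) :
    Matrix (Fin N) (Fin N) ℝ →ₗ[ℝ] MvPolynomial (Fin n) ℝ where
  toFun := gramForm n μ
  map_add' A B := by
    simp [gramForm, add_mul, Finset.sum_add_distrib]
  map_smul' c A := by
    simp [gramForm, Finset.mul_sum, MvPolynomial.smul_eq_C_mul, mul_assoc]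

theorem sublevelVol_gramForm_smul_one_ne_top {n N k : ℕ} (hk : k ≠ 0)
    {μ : Fin N → (Fin n →₀ ℕ)} (hμ : IsMonomialEnum n k μ) {c : ℝ} (hc : 0 < c) :
    sublevelVol n (gramForm n μ (c • (1 : Matrix (Fin N) (Fin N) ℝ))) ≠ ⊤ := by
  have hsub : {x : Fin n → ℝ | eval x (gramForm n μ (c • (1 : Matrix (Fin N) (Fin N) ℝ))) ≤ 1}
      ⊆ Set.Icc (fun _ => -max 1 c⁻¹) (fun _ => max 1 c⁻¹) := by
    intro x hx
    have hbound : ∀ j, |x j| ≤ max 1 c⁻¹ := by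
      intro j
      by_contra! hj
      obtain ⟨h1, h2⟩ := max_lt_iff.1 hj
      obtain ⟨i, hi⟩ := hμ.2.2 (Finsupp.single j k) (by simp [Finsupp.single_apply])
      have hx' : c * ∑ i, eval x (mPoly n μ i) ^ 2 ≤ 1 := by
        have := hx
        simp only [Set.mem_ofPred_eq] at this
        rw [eval_gramForm, smul_mulVec, one_mulVec, dotProduct_smul, smul_eq_mul] at this
        simpa [dotProduct, sq] using this
      have hterm : eval x (mPoly n μ i) ^ 2 ≤ ∑ i, eval x (mPoly n μ i) ^ 2 :=
        Finset.single_le_sum (f := fun i => eval x (mPoly n μ i) ^ 2)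
          (fun _ _ => sq_nonneg _) (Finset.mem_univ i)
      have hpow : |x j| ≤ |x j| ^ (k * 2) := le_self_pow₀ h1.le (by omega)
      have hval : |x j| ^ (k * 2) ≤ eval x (mPoly n μ i) ^ 2 := by
        have hm : (1 : ℝ) ≤ (μ i).multinomial := by
          exact_mod_cast Nat.one_le_iff_ne_zero.2
            (Nat.pos_iff_ne_zero.1 (by
              simpa [Finsupp.multinomial_eq] using Nat.multinomial_pos _ _))
        have hprod : ∏ l, x l ^ μ i l = x j ^ k := by
          rw [hi, Finset.prod_eq_single j] <;> simp +contextual [eq_comm]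
        rw [eval_mPoly, mul_pow, Real.sq_sqrt (by positivity), hprod, pow_mul, ← abs_pow,
          sq_abs]
        nlinarith [sq_nonneg (x j ^ k)]
      have : c * |x j| ≤ 1 :=
        (mul_le_mul_of_nonneg_left (hpow.trans (hval.trans hterm)) hc.le).trans hx'
      rw [inv_lt_iff_one_lt_mul₀' hc] at h2
      linarith
    exact ⟨fun j => (abs_le.1 (hbound j)).1, fun j => (abs_le.1 (hbound j)).2⟩
  exact ne_top_of_le_ne_top isCompact_Icc.measure_lt_top.ne (measure_mono hsub)

/-- The space of symmetric matrices. -/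
def symmMatrix (N : ℕ) : Submodule ℝ (Matrix (Fin N) (Fin N) ℝ) where
  carrier := {A | A.IsSymm}
  add_mem' hA hB := hA.add hB
  zero_mem' := Matrix.isSymm_zero
  smul_mem' c _ hA := hA.smul c

theorem isSymm_of_posSemidef {N : ℕ} {G : Matrix (Fin N) (Fin N) ℝ} (hG : G.PosSemidef) :
    G.IsSymm := by
  simpa [Matrix.IsHermitian, Matrix.IsSymm, Matrix.conjTranspose_eq_transpose_of_trivial]
    using hG.isHermitian

/-- The problem of minimizing `v(f)` over all sums of squares
`f(x) = m_{d/2}(x)ᵗ G m_{d/2}(x)` with `G` positive semidefinite and `‖G‖ ≤ 1`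
(for an arbitrary norm `‖·‖` on symmetric `N×N` matrices) is a convex problem
with a unique optimal solution. -/
theorem stmt6 (n d N : ℕ) (hn : 1 ≤ n) (hd : 2 ≤ d) (hdeven : Even d)
    (hN : N = Nat.choose (d / 2 + n - 1) (n - 1))
    (μ : Fin N → (Fin n →₀ ℕ)) (hμ : IsMonomialEnum n (d / 2) μ)
    (Nm : Matrix (Fin N) (Fin N) ℝ → ℝ)
    (Nm_add : ∀ A B : Matrix (Fin N) (Fin N) ℝ, A.IsSymm → B.IsSymm →
      Nm (A + B) ≤ Nm A + Nm B)
    (Nm_smul : ∀ (c : ℝ) (A : Matrix (Fin N) (Fin N) ℝ), A.IsSymm →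
      Nm (c • A) = |c| * Nm A)
    (Nm_eq_zero : ∀ A : Matrix (Fin N) (Fin N) ℝ, A.IsSymm → (Nm A = 0 ↔ A = 0)) :
    Convex ℝ {f : MvPolynomial (Fin n) ℝ |
      ∃ G : Matrix (Fin N) (Fin N) ℝ, G.PosSemidef ∧ Nm G ≤ 1 ∧ f = gramForm n μ G} ∧
    ∃! fstar : MvPolynomial (Fin n) ℝ,
      (∃ G : Matrix (Fin N) (Fin N) ℝ, G.PosSemidef ∧ Nm G ≤ 1 ∧ fstar = gramForm n μ G) ∧
      ∀ (f : MvPolynomial (Fin n) ℝ) (G : Matrix (Fin N) (Fin N) ℝ),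
        G.PosSemidef → Nm G ≤ 1 → f = gramForm n μ G →
          sublevelVol n fstar ≤ sublevelVol n f := by
  have hk : d / 2 ≠ 0 := by omega
  have hnonneg : ∀ A : Matrix (Fin N) (Fin N) ℝ, A.IsSymm → 0 ≤ Nm A := fun A hA => by
    have h1 := Nm_add A ((-1 : ℝ) • A) hA (hA.smul _)
    rw [Nm_smul _ A hA, neg_one_smul, add_neg_cancel,
      (Nm_eq_zero 0 Matrix.isSymm_zero).2 rfl] at h1
    norm_num at h1
    linarith
  let _ : Norm (symmMatrix N) := ⟨fun A => Nm A⟩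
  have core : NormedSpace.Core ℝ (symmMatrix N) :=
    { norm_nonneg := fun A => hnonneg A A.2
      norm_smul := fun c A => Nm_smul c A A.2
      norm_triangle := fun A B => Nm_add A B A.2 B.2
      norm_eq_zero_iff := fun A => (Nm_eq_zero A A.2).trans (by simp) }
  let L : (Fin N → ℝ) → symmMatrix N →ₗ[ℝ] ℝ := fun v =>
    { toFun := fun G => v ⬝ᵥ (G : Matrix (Fin N) (Fin N) ℝ) *ᵥ v
      map_add' := fun A B => by simp [add_mulVec]
      map_smul' := fun c A => by simp [smul_mulVec] }
  have hpsd : ∀ G : symmMatrix N,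
      (∀ v, 0 ≤ L v G) ↔ (G : Matrix (Fin N) (Fin N) ℝ).PosSemidef := fun G => by
    refine ⟨fun h => Matrix.PosSemidef.of_dotProduct_mulVec_nonneg ?_ h,
      fun h => h.dotProduct_mulVec_nonneg⟩
    rw [Matrix.IsHermitian, Matrix.conjTranspose_eq_transpose_of_trivial]
    exact G.2
  let Φ : symmMatrix N →ₗ[ℝ] MvPolynomial (Fin n) ℝ :=
    gramLinear n μ ∘ₗ (symmMatrix N).subtype
  have hΦ : ∀ G : symmMatrix N, Φ G = gramForm n μ G := fun _ => rfl
  have hfin : ∃ G : symmMatrix N, ((∀ v, 0 ≤ L v G) ∧ ‖G‖ ≤ 1) ∧ sublevelVol n (Φ G) ≠ ⊤ := by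
    obtain ⟨i, -⟩ := hμ.2.2 (Finsupp.single ⟨0, hn⟩ (d / 2)) (by simp [Finsupp.single_apply])
    have hone : (1 : Matrix (Fin N) (Fin N) ℝ) ≠ 0 := fun h => by
      simpa using congrFun (congrFun h i) i
    have hpos : 0 < Nm 1 := lt_of_le_of_ne (hnonneg 1 Matrix.isSymm_one)
      fun h => hone ((Nm_eq_zero 1 Matrix.isSymm_one).1 h.symm)
    refine ⟨⟨(Nm 1)⁻¹ • 1, Matrix.isSymm_one.smul _⟩, ⟨(hpsd _).2 ?_, ?_⟩, ?_⟩
    · exact Matrix.PosSemidef.one.smul (inv_pos.2 hpos).le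
    · refine (Nm_smul _ _ Matrix.isSymm_one).trans_le ?_
      rw [abs_of_pos (inv_pos.2 hpos), inv_mul_cancel₀ hpos.ne']
    · exact sublevelVol_gramForm_smul_one_ne_top hk hμ (inv_pos.2 hpos)
  obtain ⟨hconv, hmin⟩ := convex_and_existsUnique_min_sublevelVol_ball (d := d / 2 + d / 2)
    (by omega) core L Φ (fun G s _ x => eval_smul_gramForm hμ.2.1 _ s x)
    (fun G hG x => by
      rw [hΦ, eval_gramForm]
      exact hG _) hfin
  have hexists : ∀ f : MvPolynomial (Fin n) ℝ,
      (∃ G : Matrix (Fin N) (Fin N) ℝ, G.PosSemidef ∧ Nm G ≤ 1 ∧ f = gramForm n μ G) ↔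
        ∃ G ∈ {G : symmMatrix N | (∀ v, 0 ≤ L v G) ∧ ‖G‖ ≤ 1}, f = Φ G := fun f =>
    ⟨fun ⟨G, hG, hG1, h⟩ => ⟨⟨G, isSymm_of_posSemidef hG⟩, ⟨(hpsd _).2 hG, hG1⟩, h⟩,
      fun ⟨G, hG, h⟩ => ⟨G, (hpsd G).1 hG.1, hG.2, h⟩⟩
  refine ⟨?_, (existsUnique_congr fun f => ?_).2 hmin⟩
  · have himage : {f : MvPolynomial (Fin n) ℝ | ∃ G : Matrix (Fin N) (Fin N) ℝ,
        G.PosSemidef ∧ Nm G ≤ 1 ∧ f = gramForm n μ G}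
        = Φ '' {G | (∀ v, 0 ≤ L v G) ∧ ‖G‖ ≤ 1} := by
      ext f
      rw [Set.mem_ofPred_eq, hexists, Set.mem_image]
      simp only [eq_comm]
    rw [himage]
    exact hconv.linear_image Φ
  · rw [hexists]
    refine and_congr_right fun _ => ⟨fun h G hG => h _ G ((hpsd G).1 hG.1) hG.2 rfl, ?_⟩
    rintro h _ G hG hG1 rfl
    exact h ⟨G, isSymm_of_posSemidef hG⟩ ⟨(hpsd _).2 hG, hG1⟩
end

section
/- Let n ≥ 1, let d ≥ 1, and let f be a real form of degree d in n variables such that the sublevel set {x ∈ ℝⁿ : f(x) ≤ 1} has finite Lebesgue volume. Then f is nonnegative, i.e., f(x) ≥ 0 for all x ∈ ℝⁿ (and, in particular, d is even). -/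
open MvPolynomial MeasureTheory Finset

theorem MvPolynomial.IsHomogeneous.eval_smul_vec {σ R : Type*} [CommSemiring R]
    {f : MvPolynomial σ R} {d : ℕ} (hf : f.IsHomogeneous d) (c : R) (x : σ → R) :
    eval (c • x) f = c ^ d * eval x f := by
  simp only [eval_eq, Finset.mul_sum]
  refine Finset.sum_congr rfl fun m hm => ?_
  have hdeg : ∑ i ∈ m.support, m i = d := by
    rw [← Finsupp.degree_apply, Finsupp.degree_eq_weight_one]
    exact hf (mem_support_iff.mp hm)
  simp only [Pi.smul_apply, smul_eq_mul, mul_pow, Finset.prod_mul_distrib,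
    Finset.prod_pow_eq_pow_sum, hdeg]
  ring

/-- If the sublevel set `{x ∈ ℝⁿ : f(x) ≤ 1}` of a form `f` of degree `d ≥ 1` has finite
Lebesgue volume, then `f` is nonnegative; in particular `d` is even. -/
theorem stmt16 (n d : ℕ) (hn : 1 ≤ n) (hd : 1 ≤ d) (f : MvPolynomial (Fin n) ℝ)
    (hf : f.IsHomogeneous d)
    (hvol : volume {x : Fin n → ℝ | eval x f ≤ 1} < ⊤) :
    (∀ x : Fin n → ℝ, 0 ≤ eval x f) ∧ Even d := by
  have hpos : ∀ x : Fin n → ℝ, 0 ≤ eval x f := by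
    by_contra! ⟨x₀, hx₀⟩
    set C : Set (Fin n → ℝ) := {x | eval x f < 0}
    have hopen : IsOpen C := isOpen_lt (MvPolynomial.continuous_eval f) continuous_const
    have hC_pos : volume C ≠ 0 := (hopen.measure_pos volume ⟨x₀, hx₀⟩).ne'
    have hC_fin : volume C ≠ ⊤ :=
      ((measure_mono fun x (hx : eval x f < 0) => hx.le.trans zero_le_one).trans_lt hvol).ne
    have hcone : (fun x : Fin n → ℝ => (2 : ℝ) • x) ⁻¹' C = C := by
      ext x
      simp [C, hf.eval_smul_vec, mul_neg_iff]
    have hscale := Measure.addHaar_preimage_smul (volume : Measure (Fin n → ℝ))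
      (two_ne_zero : (2 : ℝ) ≠ 0) C
    rw [hcone, Module.finrank_fin_fun] at hscale
    have hone := (ENNReal.mul_eq_right hC_pos hC_fin).mp hscale.symm
    rw [ENNReal.ofReal_eq_one, abs_of_pos (by positivity), inv_eq_one] at hone
    exact (one_lt_pow₀ (one_lt_two : (1 : ℝ) < 2) (by omega : n ≠ 0)).ne' hone
  refine ⟨hpos, ?_⟩
  by_contra hodd
  rw [Nat.not_even_iff_odd] at hodd
  have hle : ∀ x : Fin n → ℝ, eval x f ≤ 1 := fun x => by
    have h := hpos ((-1 : ℝ) • x)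
    rw [hf.eval_smul_vec, hodd.neg_one_pow] at h
    linarith
  have : Nonempty (Fin n) := ⟨⟨0, hn⟩⟩
  rw [Set.eq_univ_of_forall (s := {x : Fin n → ℝ | eval x f ≤ 1}) hle,
    measure_univ_of_isAddLeftInvariant] at hvol
  exact hvol.ne rfl
end

section
/- Let n ≥ 1, let d ≥ 2 be even, and let κ = (Γ(1+n/d)/Γ(1+n/2))^{d/n} π^{d/2}. Then for every multi-index α ∈ ℕⁿ, ∫_{ℝⁿ} x^α exp(−κ|x|^d) dx = (Γ(1+(n+|α|)/d)/Γ(1+(n+|α|)/2)) · ∫_{ℝⁿ} x^α exp(−κ^{2/d}|x|²) dx, where |α| = α₁+⋯+α_n and x^α = x₁^{α₁}⋯x_n^{α_n}. -/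
open MeasureTheory Real Finset

/-- `κ = (Γ(1+n/d)/Γ(1+n/2))^{d/n} · π^{d/2}`. -/
noncomputable def kappa (n d : ℕ) : ℝ :=
  (Real.Gamma (1 + (n : ℝ) / d) / Real.Gamma (1 + (n : ℝ) / 2)) ^ ((d : ℝ) / n)
    * π ^ ((d : ℝ) / 2)

/-- Polar coordinates for the product of a function that is homogeneous of degree `N` and a radial
function. -/
theorem integral_homogeneous_mul_fun_norm {E : Type*} [NormedAddCommGroup E] [NormedSpace ℝ E]
    [MeasurableSpace E] [BorelSpace E] [FiniteDimensional ℝ E] [Nontrivial E]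
    (μ : Measure E) [μ.IsAddHaarMeasure] {N : ℕ} {g : E → ℝ}
    (hg : ∀ (r : ℝ) (x : E), 0 < r → g (r • x) = r ^ N * g x) (f : ℝ → ℝ) :
    ∫ x, g x * f ‖x‖ ∂μ = (∫ s, g s ∂μ.toSphere) *
      ∫ y in Set.Ioi (0 : ℝ), y ^ (Module.finrank ℝ E - 1) * (y ^ N * f y) :=
  calc
    ∫ x, g x * f ‖x‖ ∂μ = ∫ x : ({(0)}ᶜ : Set E), g x * f ‖x.1‖ ∂(μ.comap (↑)) := by
      rw [integral_subtype_comap (measurableSet_singleton _).compl fun x ↦ g x * f ‖x‖,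
        restrict_compl_singleton]
    _ = ∫ p : Metric.sphere (0 : E) 1 × Set.Ioi (0 : ℝ), g p.1 * ((p.2 : ℝ) ^ N * f p.2)
          ∂μ.toSphere.prod (.volumeIoiPow (Module.finrank ℝ E - 1)) := by
      rw [← μ.measurePreserving_homeomorphUnitSphereProd.integral_comp
        (Homeomorph.measurableEmbedding _)]
      refine integral_congr_ae (.of_forall fun x ↦ ?_)
      have hx : 0 < ‖x.1‖ := norm_pos_iff.2 x.2
      have h := hg ‖x.1‖ (‖x.1‖⁻¹ • x.1) hx
      rw [smul_inv_smul₀ hx.ne'] at h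
      simp only [homeomorphUnitSphereProd_apply_snd_coe, homeomorphUnitSphereProd_apply_fst_coe]
      rw [h]
      ring
    _ = (∫ s, g s ∂μ.toSphere) * ∫ y : Set.Ioi (0 : ℝ), (y : ℝ) ^ N * f y
          ∂.volumeIoiPow (Module.finrank ℝ E - 1) :=
      integral_prod_mul (fun s : Metric.sphere (0 : E) 1 ↦ g s)
        (fun y : Set.Ioi (0 : ℝ) ↦ (y : ℝ) ^ N * f y)
    _ = _ := by
      congr 1
      simp only [Measure.volumeIoiPow, ENNReal.ofReal]
      rw [integral_withDensity_eq_integral_smul,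
        integral_subtype_comap measurableSet_Ioi
          fun a ↦ Real.toNNReal (a ^ (Module.finrank ℝ E - 1)) • (a ^ N * f a),
        setIntegral_congr_fun measurableSet_Ioi fun x hx ↦ ?_]
      · rw [NNReal.smul_def, Real.coe_toNNReal _ (pow_nonneg hx.out.le _), smul_eq_mul]
      · exact (measurable_subtype_coe.pow_const _).real_toNNReal

/-- Polar coordinates for a moment of a radial function on `ℝⁿ`. -/
theorem integral_monomial_mul_fun_sqrt_sum_sq {n : ℕ} (hn : 1 ≤ n) (α : Fin n → ℕ)
    (f : ℝ → ℝ) :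
    ∫ x : Fin n → ℝ, (∏ i, x i ^ α i) * f (√(∑ i, x i ^ 2)) =
      (∫ s : Metric.sphere (0 : EuclideanSpace ℝ (Fin n)) 1, ∏ i, s.1 i ^ α i
        ∂(volume : Measure (EuclideanSpace ℝ (Fin n))).toSphere) *
      ∫ y in Set.Ioi (0 : ℝ), y ^ (n - 1) * (y ^ (∑ i, α i) * f y) := by
  have : Nonempty (Fin n) := ⟨⟨0, hn⟩⟩
  have h := integral_homogeneous_mul_fun_norm
    (volume : Measure (EuclideanSpace ℝ (Fin n))) (N := ∑ i, α i)
    (g := fun x ↦ ∏ i, x i ^ α i)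
    (fun r x _ ↦ by simp [mul_pow, prod_mul_distrib, prod_pow_eq_pow_sum]) f
  rw [finrank_euclideanSpace_fin] at h
  rw [← h, ← (PiLp.volume_preserving_toLp (Fin n)).integral_comp
    (MeasurableEquiv.toLp 2 _).measurableEmbedding]
  simp [EuclideanSpace.norm_eq]

/-- The radial integral of `y ^ (n + N - 1) * exp (-b y ^ d)`. -/
theorem integral_pow_mul_pow_mul_exp_neg_mul_pow {n d : ℕ} (hn : 1 ≤ n) (hd : 1 ≤ d) (N : ℕ)
    {b : ℝ} (hb : 0 < b) :
    ∫ y in Set.Ioi (0 : ℝ), y ^ (n - 1) * (y ^ N * Real.exp (-(b * y ^ d))) =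
      b ^ (-((n : ℝ) + N) / d) * Real.Gamma (1 + ((n : ℝ) + N) / d) / (n + N) := by
  have hn' : (0 : ℝ) < n := by exact_mod_cast hn
  have hd' : (0 : ℝ) < d := by exact_mod_cast hd
  have hM : (0 : ℝ) < n + N := by positivity
  have h := integral_rpow_mul_exp_neg_mul_rpow hd' (q := (n : ℝ) + N - 1) (by linarith) hb
  rw [sub_add_cancel] at h
  rw [add_comm 1, Real.Gamma_add_one (by positivity)]
  calc
    _ = ∫ y in Set.Ioi (0 : ℝ), y ^ ((n : ℝ) + N - 1) * Real.exp (-b * y ^ (d : ℝ)) := by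
      refine setIntegral_congr_fun measurableSet_Ioi fun y _ ↦ ?_
      have he : (n : ℝ) + N - 1 = ((n - 1 + N : ℕ) : ℝ) := by
        push_cast [hn]
        ring
      simp only [he, Real.rpow_natCast]
      rw [pow_add, neg_mul, mul_assoc]
    _ = _ := by
      rw [h]
      field_simp

theorem kappa_pos {n d : ℕ} : 0 < kappa n d := by
  unfold kappa
  have h₁ : 0 < Real.Gamma (1 + (n : ℝ) / d) := Real.Gamma_pos_of_pos (by positivity)
  have h₂ : 0 < Real.Gamma (1 + (n : ℝ) / 2) := Real.Gamma_pos_of_pos (by positivity)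
  positivity

/-- Moments of the Gaussian-like density `exp(-κ|x|^d)`: for every multi-index `α`,
`∫ x^α exp(-κ|x|^d) dx = (Γ(1+(n+|α|)/d)/Γ(1+(n+|α|)/2)) ∫ x^α exp(-κ^{2/d}|x|²) dx`. -/
theorem stmt18 (n d : ℕ) (hn : 1 ≤ n) (hd : 2 ≤ d) (hdeven : Even d) (α : Fin n → ℕ) :
    ∫ x : Fin n → ℝ,
        (∏ i, x i ^ α i) * Real.exp (-(kappa n d * Real.sqrt (∑ i, x i ^ 2) ^ d))
      = (Real.Gamma (1 + ((n : ℝ) + ∑ i, (α i : ℝ)) / d)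
            / Real.Gamma (1 + ((n : ℝ) + ∑ i, (α i : ℝ)) / 2))
          * ∫ x : Fin n → ℝ,
              (∏ i, x i ^ α i)
                * Real.exp (-(kappa n d ^ ((2 : ℝ) / d) * ∑ i, x i ^ 2)) := by
  have hd' : (0 : ℝ) < d := by exact_mod_cast (show 0 < d by omega)
  have hκ : 0 < kappa n d := kappa_pos
  have hΓ : Real.Gamma (1 + ((n : ℝ) + (∑ i, α i : ℕ)) / 2) ≠ 0 :=
    (Real.Gamma_pos_of_pos (by positivity)).ne'
  have hsq (x : Fin n → ℝ) : ∑ i, x i ^ 2 = √(∑ i, x i ^ 2) ^ 2 :=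
    (Real.sq_sqrt (by positivity)).symm
  have hgauss : ∫ x : Fin n → ℝ, (∏ i, x i ^ α i) *
        Real.exp (-(kappa n d ^ ((2 : ℝ) / d) * ∑ i, x i ^ 2)) =
      ∫ x : Fin n → ℝ, (∏ i, x i ^ α i) *
        Real.exp (-(kappa n d ^ ((2 : ℝ) / d) * √(∑ i, x i ^ 2) ^ 2)) :=
    integral_congr_ae (.of_forall fun x ↦ by simp only [← hsq x])
  have hpow : (kappa n d ^ ((2 : ℝ) / d)) ^ (-((n : ℝ) + (∑ i, α i : ℕ)) / (2 : ℕ)) =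
      kappa n d ^ (-((n : ℝ) + (∑ i, α i : ℕ)) / d) := by
    rw [← Real.rpow_mul hκ.le]
    congr 1
    push_cast
    field_simp
  rw [hgauss,
    integral_monomial_mul_fun_sqrt_sum_sq hn α fun y ↦ Real.exp (-(kappa n d * y ^ d)),
    integral_monomial_mul_fun_sqrt_sum_sq hn α
      fun y ↦ Real.exp (-(kappa n d ^ ((2 : ℝ) / d) * y ^ 2)),
    integral_pow_mul_pow_mul_exp_neg_mul_pow hn (by omega) _ hκ,
    integral_pow_mul_pow_mul_exp_neg_mul_pow hn one_le_two _ (by positivity), hpow,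
    ← Nat.cast_sum, Nat.cast_ofNat]
  field_simp
end
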